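/- arXiv:2005.13861 — 8 statements merged into one kernel-verified Lean document; each statement's English description precedes it below -/
import Mathlib

section
/- Let C be a triangulated category equipped with a cotorsion pair (S,V) such that K := add(S*V) is functorially finite in C. Then the additive quotient C/K is a preabelian category: it is additive and every morphism of C/K admits a kernel and a cokernel. -/
universe w v u v₂ u₂

open CategoryTheory Category Limits Pretriangulated

namespace PaperFormalization

variable (C : Type u) [Category.{v} C] [Preadditive C] [HasZeroObject C]
  [HasShift C ℤ] [∀ n : ℤ, (shiftFunctor C n).Additive] [Pretriangulated C]
  [IsTriangulated C] [HasBinaryBiproducts C]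

/-- `X` is a direct summand of `Z`. -/
def IsSummandOf (X Z : C) : Prop := ∃ (i : X ⟶ Z) (p : Z ⟶ X), i ≫ p = 𝟙 X

/-- The morphism `f` factors through some object of `A`. -/
def FactorsThruSet (A : Set C) {X Y : C} (f : X ⟶ Y) : Prop :=
  ∃ Z ∈ A, ∃ (a : X ⟶ Z) (b : Z ⟶ Y), a ≫ b = f

/-- A cotorsion pair `(S, V)` supported on the (triangulated) subcategory determined by
`N ⊆ C`: both classes are contained in `N`, each is closed under isomorphisms, finite
direct sums and direct summands, `Hom(S, V⟦1⟧) = 0`, and every object of `N` admits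
distinguished triangles `V' → S' → X → V'⟦1⟧` and `X → V' → S' → X⟦1⟧` with `S' ∈ S`,
`V' ∈ V`. -/
structure IsTriCotorsionPairOn (N S V : Set C) : Prop where
  S_sub : S ⊆ N
  V_sub : V ⊆ N
  S_iso : ∀ {X Y : C}, (X ≅ Y) → X ∈ S → Y ∈ S
  S_sum : ∀ {X Y : C}, X ∈ S → Y ∈ S → (X ⊞ Y) ∈ S
  S_summand : ∀ {X Z : C}, Z ∈ S → IsSummandOf C X Z → X ∈ S
  V_iso : ∀ {X Y : C}, (X ≅ Y) → X ∈ V → Y ∈ V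
  V_sum : ∀ {X Y : C}, X ∈ V → Y ∈ V → (X ⊞ Y) ∈ V
  V_summand : ∀ {X Z : C}, Z ∈ V → IsSummandOf C X Z → X ∈ V
  orth : ∀ {A B : C}, A ∈ S → B ∈ V → ∀ f : A ⟶ (B⟦(1 : ℤ)⟧), f = 0
  resolve : ∀ X ∈ N, ∃ (Vx Sx : C), Vx ∈ V ∧ Sx ∈ S ∧
    ∃ (f : Vx ⟶ Sx) (g : Sx ⟶ X) (h : X ⟶ (Vx⟦(1 : ℤ)⟧)),
      Triangle.mk f g h ∈ distTriang C
  coresolve : ∀ X ∈ N, ∃ (Vx Sx : C), Vx ∈ V ∧ Sx ∈ S ∧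
    ∃ (f : X ⟶ Vx) (g : Vx ⟶ Sx) (h : Sx ⟶ (X⟦(1 : ℤ)⟧)),
      Triangle.mk f g h ∈ distTriang C

/-- A cotorsion pair `(S, V)` on the triangulated category `C` itself. -/
abbrev IsTriCotorsionPair (S V : Set C) : Prop := IsTriCotorsionPairOn C Set.univ S V

/-- The class `S * V` of objects `Y` admitting a distinguished triangle
`S → Y → V → S⟦1⟧` with `S ∈ S`, `V ∈ V`. -/
def SstarV (S V : Set C) : Set C :=
  {Y | ∃ (S' V' : C), S' ∈ S ∧ V' ∈ V ∧
    ∃ (f : S' ⟶ Y) (g : Y ⟶ V') (h : V' ⟶ (S'⟦(1 : ℤ)⟧)),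
      Triangle.mk f g h ∈ distTriang C}

/-- Membership in the additive closure of `A`: closure of `A` under isomorphisms,
finite direct sums and direct summands. -/
inductive addMem (A : Set C) : C → Prop
  | of {X : C} : X ∈ A → addMem A X
  | iso {X Y : C} : (X ≅ Y) → addMem A X → addMem A Y
  | sum {X Y : C} : addMem A X → addMem A Y → addMem A (X ⊞ Y)
  | summand {X Z : C} : addMem A Z → IsSummandOf C X Z → addMem A X

/-- `K := add (S * V)`. -/
def Kcl (S V : Set C) : Set C := {X | addMem C (SstarV C S V) X}

/-- `A` is functorially finite: every object has a left `A`-approximation and a right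
`A`-approximation. -/
def FunctoriallyFinite (A : Set C) : Prop :=
  (∀ X : C, ∃ K ∈ A, ∃ ι : X ⟶ K, ∀ K' ∈ A, ∀ f : X ⟶ K', ∃ t : K ⟶ K', ι ≫ t = f) ∧
  (∀ X : C, ∃ K ∈ A, ∃ p : K ⟶ X, ∀ K' ∈ A, ∀ f : K' ⟶ X, ∃ t : K' ⟶ K, t ≫ p = f)

/-- The ideal-quotient relation on `C` modulo morphisms factoring through `K`;
the corresponding quotient category is the additive quotient `C/K`. -/
def Krel (S V : Set C) : HomRel C :=
  fun {X Y} f g => FactorsThruSet C (Kcl C S V) (f - g)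

/-- The additive quotient `C/K`. -/
abbrev KQuot (S V : Set C) := CategoryTheory.Quotient (Krel C S V)

/-- The additive quotient functor `ϖ : C ⥤ C/K`. -/
abbrev Kproj (S V : Set C) : C ⥤ KQuot C S V :=
  CategoryTheory.Quotient.functor (Krel C S V)

set_option linter.unusedSectionVars false

section DistinguishedTriangle

variable {C} {X Y Z : C} {f : X ⟶ Y} {g : Y ⟶ Z} {h : Z ⟶ X⟦(1 : ℤ)⟧}
  (hT : Triangle.mk f g h ∈ distTriang C)
include hT

lemma distTriang_lift₂ {A : C} (a : A ⟶ Y) (ha : a ≫ g = 0) : ∃ b : A ⟶ X, a = b ≫ f :=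
  Triangle.coyoneda_exact₂ _ hT a ha

lemma distTriang_lift₃ {A : C} (a : A ⟶ Z) (ha : a ≫ h = 0) : ∃ b : A ⟶ Y, a = b ≫ g :=
  Triangle.coyoneda_exact₃ _ hT a ha

lemma distTriang_lift_shift₁ {A : C} (a : A ⟶ X⟦(1 : ℤ)⟧) (ha : a ≫ f⟦1⟧' = 0) :
    ∃ b : A ⟶ Z, a = b ≫ h :=
  Triangle.coyoneda_exact₁ _ hT a ha

lemma distTriang_lift_shift₂ {A : C} (a : A ⟶ Y⟦(1 : ℤ)⟧) (ha : a ≫ g⟦1⟧' = 0) :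
    ∃ b : A ⟶ X⟦(1 : ℤ)⟧, a = b ≫ f⟦1⟧' := by
  obtain ⟨b, hb⟩ : ∃ b : A ⟶ X⟦(1 : ℤ)⟧, a = b ≫ (-f⟦1⟧') :=
    Triangle.coyoneda_exact₁ _ (rot_of_distTriang _ hT) a ha
  exact ⟨-b, by rw [hb, Preadditive.neg_comp, Preadditive.comp_neg]⟩

lemma distTriang_desc₂ {A : C} (a : Y ⟶ A) (ha : f ≫ a = 0) : ∃ b : Z ⟶ A, a = g ≫ b :=
  Triangle.yoneda_exact₂ _ hT a ha

lemma distTriang_desc₃ {A : C} (a : Z ⟶ A) (ha : g ≫ a = 0) :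
    ∃ b : X⟦(1 : ℤ)⟧ ⟶ A, a = h ≫ b :=
  Triangle.yoneda_exact₃ _ hT a ha

lemma distTriang_desc₁ {A : C} (a : X ⟶ A) (ha : h ≫ a⟦1⟧' = 0) : ∃ b : Y ⟶ A, a = f ≫ b := by
  obtain ⟨b, hb⟩ : ∃ b : Y⟦(1 : ℤ)⟧ ⟶ A⟦(1 : ℤ)⟧, a⟦1⟧' = (-f⟦1⟧') ≫ b :=
    Triangle.yoneda_exact₃ _ (rot_of_distTriang _ hT) _ ha
  refine ⟨-(shiftFunctor C (1 : ℤ)).preimage b, (shiftFunctor C (1 : ℤ)).map_injective ?_⟩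
  rw [hb, Functor.map_comp, Functor.map_neg, Functor.map_preimage, Preadditive.neg_comp,
    Preadditive.comp_neg]

end DistinguishedTriangle

/-- `f` is annihilated by every composition `A ⟶ X ⟶ Y ⟶ B⟦1⟧` with `A⟦1⟧ ∈ S` and `B ∈ V`.
For a cotorsion pair `(S, V)` these are the morphisms factoring through `Kcl C S V`. -/
def IsPhantom (S V : Set C) {X Y : C} (f : X ⟶ Y) : Prop :=
  ∀ ⦃A B : C⦄, A⟦(1 : ℤ)⟧ ∈ S → B ∈ V → ∀ (a : A ⟶ X) (b : Y ⟶ B⟦(1 : ℤ)⟧), a ≫ f ≫ b = 0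

section

variable {C} {S V : Set C}

lemma IsPhantom.comp_right {X Y Z : C} {f : X ⟶ Y} (hf : IsPhantom C S V f) (g : Y ⟶ Z) :
    IsPhantom C S V (f ≫ g) := fun A B hA hB a b => by
  simpa using hf hA hB a (g ≫ b)

lemma IsPhantom.comp_left {X Y Z : C} {g : Y ⟶ Z} (hg : IsPhantom C S V g) (f : X ⟶ Y) :
    IsPhantom C S V (f ≫ g) := fun A B hA hB a b => by
  simpa using hg hA hB (a ≫ f) b

lemma IsPhantom.add {X Y : C} {f g : X ⟶ Y} (hf : IsPhantom C S V f) (hg : IsPhantom C S V g) :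
    IsPhantom C S V (f + g) := fun A B hA hB a b => by
  rw [Preadditive.add_comp, Preadditive.comp_add, hf hA hB, hg hA hB, add_zero]

lemma IsPhantom.neg {X Y : C} {f : X ⟶ Y} (hf : IsPhantom C S V f) :
    IsPhantom C S V (-f) := fun A B hA hB a b => by
  rw [Preadditive.neg_comp, Preadditive.comp_neg, hf hA hB, neg_zero]

lemma isPhantom_zero {X Y : C} : IsPhantom C S V (0 : X ⟶ Y) := fun A B _ _ a b => by simp

namespace IsTriCotorsionPairOn

variable (hP : IsTriCotorsionPair C S V)
include hP

lemma eq_zero_of_shift_mem {A B : C} (hA : A⟦(1 : ℤ)⟧ ∈ S) (hB : B ∈ V) (f : A ⟶ B) : f = 0 :=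
  (shiftFunctor C (1 : ℤ)).map_injective (by rw [hP.orth hA hB (f⟦1⟧'), Functor.map_zero])

lemma zero_mem_S {Z : C} (hZ : IsZero Z) : Z ∈ S := by
  obtain ⟨_, Sx, _, hS, _⟩ := hP.resolve Z trivial
  exact hP.S_summand hS ⟨0, 0, hZ.eq_of_src _ _⟩

lemma zero_mem_V {Z : C} (hZ : IsZero Z) : Z ∈ V := by
  obtain ⟨Vx, _, hV, _⟩ := hP.resolve Z trivial
  exact hP.V_summand hV ⟨0, 0, hZ.eq_of_src _ _⟩

lemma mem_Kcl_of_mem_S {X : C} (hX : X ∈ S) : X ∈ Kcl C S V :=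
  .of ⟨X, _, hX, hP.zero_mem_V (isZero_zero C), 𝟙 X, 0, 0, contractible_distinguished X⟩

lemma mem_Kcl_of_mem_V {X : C} (hX : X ∈ V) : X ∈ Kcl C S V :=
  .of ⟨_, X, hP.zero_mem_S (isZero_zero C), hX, 0, 𝟙 X, 0, contractible_distinguished₁ X⟩

lemma exists_coresolution (X : C) : ∃ (A B : C), A⟦(1 : ℤ)⟧ ∈ S ∧ B ∈ V ∧
    ∃ (f : A ⟶ X) (g : X ⟶ B) (h : B ⟶ A⟦(1 : ℤ)⟧), Triangle.mk f g h ∈ distTriang C := by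
  obtain ⟨Vx, Sx, hV, hS, f, g, h, hT⟩ := hP.coresolve X trivial
  exact ⟨Sx⟦(-1 : ℤ)⟧, Vx, hP.S_iso ((shiftEquiv C (1 : ℤ)).counitIso.app Sx).symm hS, hV,
    _, _, _, inv_rot_of_distTriang _ hT⟩

lemma isPhantom_of_mem_Kcl {X : C} (hX : X ∈ Kcl C S V) : IsPhantom C S V (𝟙 X) := by
  change addMem C _ X at hX
  induction hX with
  | of h =>
    obtain ⟨S', V', hS, hV, f, g, h, hT⟩ := h
    intro A B hA hB a b
    obtain ⟨a', rfl⟩ := distTriang_lift₂ hT a (hP.eq_zero_of_shift_mem hA hV _)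
    rw [id_comp, assoc, hP.orth hS hB (f ≫ b), comp_zero]
  | iso e _ ih => simpa using (ih.comp_left e.inv).comp_right e.hom
  | sum _ _ ih₁ ih₂ =>
    rw [← biprod.total]
    simpa using ((ih₁.comp_left biprod.fst).comp_right biprod.inl).add
      ((ih₂.comp_left biprod.snd).comp_right biprod.inr)
  | summand _ h ih =>
    obtain ⟨i, p, hip⟩ := h
    simpa [hip] using (ih.comp_left i).comp_right p

lemma factorsThruSet_iff_isPhantom {X Y : C} (f : X ⟶ Y) :
    FactorsThruSet C (Kcl C S V) f ↔ IsPhantom C S V f := by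
  constructor
  · rintro ⟨Z, hZ, a, b, rfl⟩
    simpa using ((hP.isPhantom_of_mem_Kcl hZ).comp_right b).comp_left a
  intro hf
  obtain ⟨A, V₀, hA, hV₀, u, v, δ, hT⟩ := hP.exists_coresolution X
  obtain ⟨V₁, S₀, hV₁, hS₀, i, b, c, hT'⟩ := hP.resolve Y trivial
  obtain ⟨s, hs⟩ : ∃ s : A ⟶ S₀, u ≫ f = s ≫ b :=
    distTriang_lift₃ hT' (u ≫ f) (by rw [assoc, hf hA hV₁])
  obtain ⟨P, ι, π, hP'⟩ := distinguished_cocone_triangle₂ (δ ≫ s⟦1⟧')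
  obtain ⟨q, hq₁, hq₂⟩ := complete_distinguished_triangle_morphism₂ _ _ hT hP' s (𝟙 V₀)
    (id_comp _).symm
  change X ⟶ P at q
  change u ≫ q = s ≫ ι at hq₁
  change v ≫ 𝟙 V₀ = q ≫ π at hq₂
  obtain ⟨r, hr⟩ : ∃ r : P ⟶ Y, b = ι ≫ r := by
    refine distTriang_desc₁ hP' b ?_
    have hδu : δ ≫ u⟦1⟧' = 0 := comp_distTriang_mor_zero₃₁ _ hT
    rw [assoc, ← Functor.map_comp, ← hs, Functor.map_comp, reassoc_of% hδu, zero_comp]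
  obtain ⟨e, he⟩ : ∃ e : V₀ ⟶ Y, f - q ≫ r = v ≫ e :=
    distTriang_desc₂ hT (f - q ≫ r) (by
      rw [Preadditive.comp_sub, reassoc_of% hq₁, ← hr, hs, sub_self])
  refine ⟨P, .of ⟨S₀, V₀, hS₀, hV₀, ι, π, _, hP'⟩, q, r + π ≫ e, ?_⟩
  rw [Preadditive.comp_add, ← reassoc_of% hq₂, ← he, add_sub_cancel]

/-- If every morphism from an object of `S` to `Y` lifts along `f`, the fibre of `f` is
monomorphic modulo phantoms. -/
lemma isPhantom_of_comp_fiber {X Y Z : C} {g : Z ⟶ X} {f : X ⟶ Y} {h : Y ⟶ Z⟦(1 : ℤ)⟧}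
    (hT : Triangle.mk g f h ∈ distTriang C)
    (hf : ∀ A ∈ S, ∀ a : A ⟶ Y, ∃ t : A ⟶ X, t ≫ f = a)
    {W : C} (w : W ⟶ Z) (hw : IsPhantom C S V (w ≫ g)) : IsPhantom C S V w := by
  intro A B hA hB a β
  have hgf : g ≫ f = 0 := comp_distTriang_mor_zero₁₂ _ hT
  have hfh : f ≫ h = 0 := comp_distTriang_mor_zero₂₃ _ hT
  obtain ⟨V₁, S₁, hV₁, hS₁, i, b, c, hX⟩ := hP.resolve X trivial
  obtain ⟨V₂, S₂, hV₂, hS₂, ζ, σ, τ, hY⟩ := hP.resolve Y trivial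
  obtain ⟨s, hs⟩ : ∃ s : A ⟶ S₁, a ≫ w ≫ g = s ≫ b :=
    distTriang_lift₃ hX (a ≫ w ≫ g) (by rw [assoc, hw hA hV₁])
  obtain ⟨e, he⟩ : ∃ e : S₁ ⟶ S₂, b ≫ f = e ≫ σ :=
    distTriang_lift₃ hY (b ≫ f) (hP.orth hS₁ hV₂ _)
  obtain ⟨σ', hσ'⟩ := hf S₂ hS₂ σ
  obtain ⟨b', hb'⟩ : ∃ b' : S₁ ⟶ Z, b - e ≫ σ' = b' ≫ g :=
    distTriang_lift₂ hT (b - e ≫ σ') (by rw [Preadditive.sub_comp, assoc, hσ', he, sub_self])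
  have hse : s ≫ e = 0 := by
    obtain ⟨k, hk⟩ : ∃ k : A ⟶ V₂, s ≫ e = k ≫ ζ :=
      distTriang_lift₂ hY (s ≫ e) (by
        rw [assoc, ← he, ← reassoc_of% hs, hgf, comp_zero, comp_zero])
    rw [hk, hP.eq_zero_of_shift_mem hA hV₂ k, zero_comp]
  have hm : (a ≫ w - s ≫ b') ≫ g = 0 := by
    rw [Preadditive.sub_comp, assoc, assoc, hs, ← hb', Preadditive.comp_sub,
      reassoc_of% hse, zero_comp, sub_zero, sub_self]
  have hm' : a ≫ w - s ≫ b' = 0 := by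
    apply (shiftFunctor C (1 : ℤ)).map_injective
    obtain ⟨n, hn⟩ := distTriang_lift_shift₁ hT ((a ≫ w - s ≫ b')⟦1⟧') (by
      rw [← Functor.map_comp, hm, Functor.map_zero])
    obtain ⟨d, hd⟩ : ∃ d : V₂⟦(1 : ℤ)⟧ ⟶ Z⟦(1 : ℤ)⟧, h = τ ≫ d :=
      distTriang_desc₃ hY h (by rw [← hσ', assoc, hfh, comp_zero])
    rw [hn, hd, reassoc_of% (hP.orth hA hV₂ (n ≫ τ) : n ≫ τ = 0), zero_comp, Functor.map_zero]
  rw [← assoc, sub_eq_zero.1 hm', assoc, hP.orth hS₁ hB (b' ≫ β), comp_zero]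

/-- If every morphism from `X` to an object of `V` extends along `f`, the cofibre of `f` is
epimorphic modulo phantoms. -/
lemma isPhantom_of_cofiber_comp {X Y Z : C} {f : X ⟶ Y} {g : Y ⟶ Z} {h : Z ⟶ X⟦(1 : ℤ)⟧}
    (hT : Triangle.mk f g h ∈ distTriang C)
    (hf : ∀ B ∈ V, ∀ b : X ⟶ B, ∃ t : Y ⟶ B, f ≫ t = b)
    {W : C} (w : Z ⟶ W) (hw : IsPhantom C S V (g ≫ w)) : IsPhantom C S V w := by
  intro A B hA hB a β
  have hfg : f ≫ g = 0 := comp_distTriang_mor_zero₁₂ _ hT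
  have hhf : h ≫ f⟦1⟧' = 0 := comp_distTriang_mor_zero₃₁ _ hT
  obtain ⟨A₁, V₁, hA₁, hV₁, i, b, c, hY⟩ := hP.exists_coresolution Y
  obtain ⟨A₂, V₂, hA₂, hV₂, σ, τ, ζ, hX⟩ := hP.exists_coresolution X
  obtain ⟨s, hs⟩ : ∃ s : V₁ ⟶ B⟦(1 : ℤ)⟧, g ≫ w ≫ β = b ≫ s :=
    distTriang_desc₂ hY (g ≫ w ≫ β) (by rw [← assoc g, hw hA₁ hB])
  obtain ⟨e, he⟩ : ∃ e : V₂ ⟶ V₁, f ≫ b = τ ≫ e :=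
    distTriang_desc₂ hX (f ≫ b) (hP.eq_zero_of_shift_mem hA₂ hV₁ _)
  obtain ⟨τ', hτ'⟩ := hf V₂ hV₂ τ
  obtain ⟨b', hb'⟩ : ∃ b' : Z ⟶ V₁, b - τ' ≫ e = g ≫ b' :=
    distTriang_desc₂ hT (b - τ' ≫ e) (by rw [Preadditive.comp_sub, reassoc_of% hτ', he, sub_self])
  have hes : e ≫ s = 0 := by
    obtain ⟨k, hk⟩ : ∃ k : A₂⟦(1 : ℤ)⟧ ⟶ B⟦(1 : ℤ)⟧, e ≫ s = ζ ≫ k :=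
      distTriang_desc₃ hX (e ≫ s) (by
        rw [← reassoc_of% he, ← hs, reassoc_of% hfg, zero_comp])
    rw [hk, hP.orth hA₂ hB k, comp_zero]
  have hm : g ≫ (w ≫ β - b' ≫ s) = 0 := by
    rw [Preadditive.comp_sub, hs, ← assoc g, ← hb', Preadditive.sub_comp, assoc τ',
      hes, comp_zero, sub_zero, sub_self]
  obtain ⟨n, hn⟩ : ∃ n : X⟦(1 : ℤ)⟧ ⟶ B⟦(1 : ℤ)⟧, w ≫ β - b' ≫ s = h ≫ n :=
    distTriang_desc₃ hT _ hm
  obtain ⟨d, hd⟩ : ∃ d : Z ⟶ A₂⟦(1 : ℤ)⟧, h = d ≫ σ⟦1⟧' :=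
    distTriang_lift_shift₂ hX h (by
      rw [← hτ', Functor.map_comp, reassoc_of% hhf, zero_comp])
  have hσn : σ⟦1⟧' ≫ n = 0 := hP.orth hA₂ hB _
  rw [hd, assoc, hσn, comp_zero, sub_eq_zero] at hn
  rw [hn, ← assoc, hP.eq_zero_of_shift_mem hA hV₁ (a ≫ b'), zero_comp]

lemma exists_kernel_mod_phantom (hff : FunctoriallyFinite C (Kcl C S V)) {X Y : C} (f : X ⟶ Y) :
    ∃ (Z : C) (g : Z ⟶ X), IsPhantom C S V (g ≫ f) ∧
      (∀ ⦃W : C⦄ (w : W ⟶ X), IsPhantom C S V (w ≫ f) → ∃ t : W ⟶ Z, t ≫ g = w) ∧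
      ∀ ⦃W : C⦄ (w : W ⟶ Z), IsPhantom C S V (w ≫ g) → IsPhantom C S V w := by
  obtain ⟨K, hK, p, hp⟩ := hff.2 Y
  obtain ⟨Z, g, h, hT⟩ := distinguished_cocone_triangle₁ (biprod.desc f p)
  have hgf : g ≫ biprod.desc f p = 0 := comp_distTriang_mor_zero₁₂ _ hT
  have hsnd : ∀ ⦃W : C⦄ (w : W ⟶ X ⊞ K), IsPhantom C S V (w ≫ biprod.snd) := fun W w => by
    simpa using (hP.isPhantom_of_mem_Kcl hK).comp_left (w ≫ biprod.snd)
  refine ⟨Z, g ≫ biprod.fst, ?_, fun W w hw => ?_, fun W w hw => ?_⟩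
  · rw [biprod.desc_eq, Preadditive.comp_add, add_eq_zero_iff_eq_neg, ← assoc, ← assoc] at hgf
    rw [hgf]
    exact ((hsnd g).comp_right p).neg
  · obtain ⟨K', hK', a, b, hab⟩ := (hP.factorsThruSet_iff_isPhantom _).2 hw
    obtain ⟨t, rfl⟩ := hp K' hK' b
    obtain ⟨l, hl⟩ := distTriang_lift₂ hT (biprod.lift w (-(a ≫ t))) (by simp [← hab])
    exact ⟨l, by rw [← assoc, ← hl, biprod.lift_fst]⟩
  · refine hP.isPhantom_of_comp_fiber hT (fun A hA a => ?_) w ?_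
    · obtain ⟨t, ht⟩ := hp A (hP.mem_Kcl_of_mem_S hA) a
      exact ⟨t ≫ biprod.inr, by simp [ht]⟩
    · rw [← comp_id (w ≫ g), ← biprod.total, Preadditive.comp_add]
      simpa using (hw.comp_right biprod.inl).add ((hsnd (w ≫ g)).comp_right biprod.inr)

lemma exists_cokernel_mod_phantom (hff : FunctoriallyFinite C (Kcl C S V)) {X Y : C}
    (f : X ⟶ Y) :
    ∃ (Z : C) (g : Y ⟶ Z), IsPhantom C S V (f ≫ g) ∧
      (∀ ⦃W : C⦄ (w : Y ⟶ W), IsPhantom C S V (f ≫ w) → ∃ t : Z ⟶ W, g ≫ t = w) ∧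
      ∀ ⦃W : C⦄ (w : Z ⟶ W), IsPhantom C S V (g ≫ w) → IsPhantom C S V w := by
  obtain ⟨K, hK, i, hi⟩ := hff.1 X
  obtain ⟨Z, g, h, hT⟩ := distinguished_cocone_triangle (biprod.lift f i)
  have hfg : biprod.lift f i ≫ g = 0 := comp_distTriang_mor_zero₁₂ _ hT
  have hinr : ∀ ⦃W : C⦄ (w : Y ⊞ K ⟶ W), IsPhantom C S V (biprod.inr ≫ w) := fun W w => by
    simpa using (hP.isPhantom_of_mem_Kcl hK).comp_right (biprod.inr ≫ w)
  refine ⟨Z, biprod.inl ≫ g, ?_, fun W w hw => ?_, fun W w hw => ?_⟩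
  · rw [biprod.lift_eq, Preadditive.add_comp, add_eq_zero_iff_eq_neg, assoc, assoc] at hfg
    rw [hfg]
    exact ((hinr g).comp_left i).neg
  · obtain ⟨K', hK', a, b, hab⟩ := (hP.factorsThruSet_iff_isPhantom _).2 hw
    obtain ⟨t, rfl⟩ := hi K' hK' a
    obtain ⟨l, hl⟩ := distTriang_desc₂ hT (biprod.desc w (-(t ≫ b))) (by simp [← hab])
    exact ⟨l, by rw [assoc, ← hl, biprod.inl_desc]⟩
  · refine hP.isPhantom_of_cofiber_comp hT (fun B hB b => ?_) w ?_
    · obtain ⟨t, ht⟩ := hi B (hP.mem_Kcl_of_mem_V hB) b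
      exact ⟨biprod.snd ≫ t, by simp [ht]⟩
    · rw [← id_comp (g ≫ w), ← biprod.total, Preadditive.add_comp]
      simpa using (hw.comp_left biprod.fst).add ((hinr (g ≫ w)).comp_left biprod.snd)

lemma krel_iff {X Y : C} (f g : X ⟶ Y) : Krel C S V f g ↔ IsPhantom C S V (f - g) :=
  hP.factorsThruSet_iff_isPhantom _

lemma congruence_krel : Congruence (Krel C S V) where
  comp_left f g g' h := by
    rw [hP.krel_iff] at h ⊢
    simpa using h.comp_left f
  comp_right g h := by
    rw [hP.krel_iff] at h ⊢
    simpa using h.comp_right g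
  equivalence :=
    { refl f := by simpa [hP.krel_iff] using isPhantom_zero
      symm h := by
        rw [hP.krel_iff] at h ⊢
        simpa using h.neg
      trans h₁ h₂ := by
        rw [hP.krel_iff] at h₁ h₂ ⊢
        simpa using h₁.add h₂ }

end IsTriCotorsionPairOn

end

section EssSurj

variable {D E : Type*} [Category* D] [Category* E] [Preadditive D] [Preadditive E] (F : D ⥤ E)
  [F.Additive] [F.EssSurj]

include F in
lemma hasFiniteBiproducts_of_essSurj [HasZeroObject D] [HasBinaryBiproducts D] :
    HasFiniteBiproducts E := by
  obtain ⟨Z, hZ⟩ := HasZeroObject.zero (C := D)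
  have : HasZeroObject E := ⟨F.obj Z, F.map_isZero hZ⟩
  have := preservesBinaryBiproducts_of_preservesBiproducts F
  have : HasBinaryBiproducts E := ⟨fun X Y =>
    hasBinaryBiproduct_of_iso (F.objObjPreimageIso X) (F.objObjPreimageIso Y)⟩
  have : HasFiniteProducts E := hasFiniteProducts_of_has_binary_and_terminal
  exact .of_hasFiniteProducts

lemma hasKernels_of_full_of_essSurj [F.Full]
    (hF : ∀ ⦃X Y : D⦄ (f : X ⟶ Y), ∃ (Z : D) (g : Z ⟶ X), F.map (g ≫ f) = 0 ∧
      (∀ ⦃W : D⦄ (w : W ⟶ X), F.map (w ≫ f) = 0 → ∃ t : W ⟶ Z, t ≫ g = w) ∧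
      ∀ ⦃W : D⦄ (w : W ⟶ Z), F.map (w ≫ g) = 0 → F.map w = 0) : HasKernels E where
  has_limit {X Y} f := by
    let eX := F.objObjPreimageIso X
    let eY := F.objObjPreimageIso Y
    obtain ⟨f', hf'⟩ := F.map_surjective (eX.hom ≫ f ≫ eY.inv)
    obtain ⟨Z, g, hgf, hlift, hmono⟩ := hF f'
    have hf : F.map f' ≫ eY.hom = eX.hom ≫ f := by simp [hf']
    have : Mono (F.map g ≫ eX.hom) := Preadditive.mono_of_cancel_zero _ fun {W} w hw => by
      obtain ⟨w', hw'⟩ := F.map_surjective ((F.objObjPreimageIso W).hom ≫ w)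
      have : F.map w' = 0 := hmono w' (by
        rw [← cancel_mono eX.hom, F.map_comp, hw', assoc, assoc, hw, comp_zero, zero_comp])
      rw [← cancel_epi (F.objObjPreimageIso W).hom, ← hw', this, comp_zero]
    refine ⟨⟨_, KernelFork.IsLimit.ofι' (F.map g ≫ eX.hom) ?_ fun {W} w hw =>
      Classical.choice ?_⟩⟩
    · rw [assoc, ← hf, ← F.map_comp_assoc, hgf, zero_comp]
    · obtain ⟨w', hw'⟩ := F.map_surjective ((F.objObjPreimageIso W).hom ≫ w ≫ eX.inv)
      obtain ⟨t, rfl⟩ := hlift w' (by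
        rw [← cancel_mono eY.hom, F.map_comp, hw', assoc, hf]
        simp [hw])
      exact ⟨(F.objObjPreimageIso W).inv ≫ F.map t, by
        rw [assoc, ← F.map_comp_assoc, hw']
        simp⟩

lemma hasCokernels_of_full_of_essSurj [F.Full]
    (hF : ∀ ⦃X Y : D⦄ (f : X ⟶ Y), ∃ (Z : D) (g : Y ⟶ Z), F.map (f ≫ g) = 0 ∧
      (∀ ⦃W : D⦄ (w : Y ⟶ W), F.map (f ≫ w) = 0 → ∃ t : Z ⟶ W, g ≫ t = w) ∧
      ∀ ⦃W : D⦄ (w : Z ⟶ W), F.map (g ≫ w) = 0 → F.map w = 0) : HasCokernels E where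
  has_colimit {X Y} f := by
    let eX := F.objObjPreimageIso X
    let eY := F.objObjPreimageIso Y
    obtain ⟨f', hf'⟩ := F.map_surjective (eX.hom ≫ f ≫ eY.inv)
    obtain ⟨Z, g, hfg, hdesc, hepi⟩ := hF f'
    have hf : eX.inv ≫ F.map f' = f ≫ eY.inv := by simp [hf']
    have : Epi (eY.inv ≫ F.map g) := Preadditive.epi_of_cancel_zero _ fun {W} w hw => by
      obtain ⟨w', hw'⟩ := F.map_surjective (w ≫ (F.objObjPreimageIso W).inv)
      have : F.map w' = 0 := hepi w' (by
        rw [← cancel_epi eY.inv, F.map_comp, hw', ← assoc, ← assoc, hw, comp_zero, zero_comp])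
      rw [← cancel_mono (F.objObjPreimageIso W).inv, ← hw', this, zero_comp]
    refine ⟨⟨_, CokernelCofork.IsColimit.ofπ' (eY.inv ≫ F.map g) ?_ fun {W} w hw =>
      Classical.choice ?_⟩⟩
    · rw [← reassoc_of% hf, ← F.map_comp, hfg, comp_zero]
    · obtain ⟨w', hw'⟩ := F.map_surjective (eY.hom ≫ w ≫ (F.objObjPreimageIso W).inv)
      obtain ⟨t, rfl⟩ := hdesc w' (by
        rw [← cancel_epi eX.inv, F.map_comp, hw', reassoc_of% hf]
        simp [reassoc_of% hw])
      exact ⟨F.map t ≫ (F.objObjPreimageIso W).hom, by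
        rw [assoc, ← F.map_comp_assoc, hw']
        simp⟩

end EssSurj

/-- If `K = add (S * V)` is functorially finite, then the additive
quotient `C/K` is preabelian: it carries a preadditive structure (making the quotient
functor additive, with finite biproducts) in which every morphism has a kernel and a
cokernel. -/
theorem statement1 (S V : Set C) (hP : IsTriCotorsionPair C S V)
    (hff : FunctoriallyFinite C (Kcl C S V)) :
    ∃ h : Preadditive (KQuot C S V),
      (@Functor.Additive C (KQuot C S V) _ _ _ h (Kproj C S V)) ∧
      (@HasFiniteBiproducts (KQuot C S V) _
        (@Preadditive.preadditiveHasZeroMorphisms _ _ h)) ∧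
      (@HasKernels (KQuot C S V) _
        (@Preadditive.preadditiveHasZeroMorphisms _ _ h)) ∧
      (@HasCokernels (KQuot C S V) _
        (@Preadditive.preadditiveHasZeroMorphisms _ _ h)) := by
  have := hP.congruence_krel
  have hadd : ∀ ⦃X Y : C⦄ (f₁ f₂ g₁ g₂ : X ⟶ Y), Krel C S V f₁ f₂ → Krel C S V g₁ g₂ →
      Krel C S V (f₁ + g₁) (f₂ + g₂) := fun X Y f₁ f₂ g₁ g₂ hf hg => by
    rw [hP.krel_iff] at hf hg ⊢
    rw [add_sub_add_comm]
    exact hf.add hg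
  let : Preadditive (KQuot C S V) := Quotient.preadditive _ hadd
  have : (Kproj C S V).Additive := Quotient.functor_additive _ hadd
  have hmap {X Y : C} (f : X ⟶ Y) : (Kproj C S V).map f = 0 ↔ IsPhantom C S V f := by
    rw [← Functor.map_zero (Kproj C S V) X Y, Quotient.functor_map_eq_iff, hP.krel_iff, sub_zero]
  refine ⟨inferInstance, inferInstance, hasFiniteBiproducts_of_essSurj (Kproj C S V),
    hasKernels_of_full_of_essSurj (Kproj C S V) fun X Y f => ?_,
    hasCokernels_of_full_of_essSurj (Kproj C S V) fun X Y f => ?_⟩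
  · simpa only [hmap] using hP.exists_kernel_mod_phantom hff f
  · simpa only [hmap] using hP.exists_cokernel_mod_phantom hff f

end PaperFormalization
end

section
/- Let C be a triangulated category equipped with a cotorsion pair (S,V) such that K := add(S*V) is functorially finite in C. Then the preabelian category C/K is integral: in any pullback square in C/K, if one of the two parallel pairs contains an epimorphism on the bottom then the opposite (top) morphism is an epimorphism, and dually, in any pushout square in C/K the pushout of a monomorphism along an arbitrary morphism is a monomorphism. -/
universe w v u v₂ u₂

open CategoryTheory Category Limits Pretriangulated

namespace PaperFormalization

variable (C : Type u) [Category.{v} C] [Preadditive C] [HasZeroObject C]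
  [HasShift C ℤ] [∀ n : ℤ, (shiftFunctor C n).Additive] [Pretriangulated C]
  [IsTriangulated C] [HasBinaryBiproducts C]

section Nullity

variable {C}

/-- A morphism out of the first vertex of a distinguished triangle extends along the first
morphism as soon as the connecting morphism kills its shift. -/
lemma exists_mor₁_comp_eq {X Y Z W : C} {f : X ⟶ Y} {g : Y ⟶ Z} {h : Z ⟶ X⟦(1 : ℤ)⟧}
    (hT : Triangle.mk f g h ∈ distTriang C) (u : X ⟶ W) (hu : h ≫ u⟦(1 : ℤ)⟧' = 0) :
    ∃ v : Y ⟶ W, u = f ≫ v := by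
  obtain ⟨v, hv⟩ : ∃ v : Y⟦(1 : ℤ)⟧ ⟶ W⟦(1 : ℤ)⟧, u⟦(1 : ℤ)⟧' = (-f⟦(1 : ℤ)⟧') ≫ v :=
    Triangle.yoneda_exact₃ _ (rot_of_distTriang _ hT) (u⟦(1 : ℤ)⟧') hu
  obtain ⟨v, rfl⟩ := (shiftFunctor C (1 : ℤ)).map_surjective v
  exact ⟨-v, (shiftFunctor C (1 : ℤ)).map_injective (by simp [hv])⟩

/-- A morphism into the shift of the second vertex of a distinguished triangle lifts along the
shift of the first morphism as soon as the shift of the second morphism kills it. -/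
lemma exists_comp_shift_mor₁_eq {X Y Z W : C} {f : X ⟶ Y} {g : Y ⟶ Z}
    {h : Z ⟶ X⟦(1 : ℤ)⟧} (hT : Triangle.mk f g h ∈ distTriang C) (u : W ⟶ Y⟦(1 : ℤ)⟧)
    (hu : u ≫ g⟦(1 : ℤ)⟧' = 0) : ∃ v : W ⟶ X⟦(1 : ℤ)⟧, u = v ≫ f⟦(1 : ℤ)⟧' := by
  obtain ⟨v, hv⟩ : ∃ v : W ⟶ X⟦(1 : ℤ)⟧, u = v ≫ (-f⟦(1 : ℤ)⟧') :=
    Triangle.coyoneda_exact₁ _ (rot_of_distTriang _ hT) u hu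
  exact ⟨-v, by simp [hv]⟩

/-- A morphism into the shift of the third vertex of a distinguished triangle lifts along the
shift of the second morphism as soon as the shift of the connecting morphism kills it. -/
lemma exists_comp_shift_mor₂_eq {X Y Z W : C} {f : X ⟶ Y} {g : Y ⟶ Z}
    {h : Z ⟶ X⟦(1 : ℤ)⟧} (hT : Triangle.mk f g h ∈ distTriang C) (u : W ⟶ Z⟦(1 : ℤ)⟧)
    (hu : u ≫ h⟦(1 : ℤ)⟧' = 0) : ∃ v : W ⟶ Y⟦(1 : ℤ)⟧, u = v ≫ g⟦(1 : ℤ)⟧' :=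
  exists_comp_shift_mor₁_eq (rot_of_distTriang _ hT) u hu

/-- The morphism `f` is annihilated on both sides: every composite
`A ⟶ X⟦1⟧ ⟶ Y⟦1⟧ ⟶ B⟦1⟧⟦1⟧` with `A ∈ S` and `B ∈ V` induced by `f` vanishes. -/
def IsNull (S V : Set C) {X Y : C} (f : X ⟶ Y) : Prop :=
  ∀ ⦃A B : C⦄, A ∈ S → B ∈ V → ∀ (a : A ⟶ X⟦(1 : ℤ)⟧) (b : Y ⟶ B⟦(1 : ℤ)⟧),
    a ≫ f⟦(1 : ℤ)⟧' ≫ b⟦(1 : ℤ)⟧' = 0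

namespace IsNull

variable {S V : Set C} {X Y Z : C}

lemma zero : IsNull S V (0 : X ⟶ Y) := fun _ _ _ _ a b => by simp

lemma neg {f : X ⟶ Y} (hf : IsNull S V f) : IsNull S V (-f) := fun _ _ hA hB a b => by
  simp [hf hA hB a b]

lemma add {f g : X ⟶ Y} (hf : IsNull S V f) (hg : IsNull S V g) : IsNull S V (f + g) :=
  fun _ _ hA hB a b => by
    simp [Functor.map_add, hf hA hB a b, hg hA hB a b]

lemma comp_left (g : X ⟶ Y) {f : Y ⟶ Z} (hf : IsNull S V f) : IsNull S V (g ≫ f) :=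
  fun _ _ hA hB a b => by
    simpa using hf hA hB (a ≫ g⟦(1 : ℤ)⟧') b

lemma comp_right {f : X ⟶ Y} (hf : IsNull S V f) (g : Y ⟶ Z) : IsNull S V (f ≫ g) :=
  fun _ _ hA hB a b => by
    simpa using hf hA hB a (g ≫ b)

lemma of_factorsThru {A : Set C} (hA : ∀ K ∈ A, IsNull S V (𝟙 K)) {f : X ⟶ Y}
    (hf : FactorsThruSet C A f) : IsNull S V f := by
  obtain ⟨K, hK, a, b, rfl⟩ := hf
  simpa using ((hA K hK).comp_left a).comp_right b

/-- The composite of a null morphism with a morphism to `B⟦1⟧`, `B ∈ V`, extends along a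
coresolution of its source. -/
lemma exists_comp_eq {B V₀ S₀ : C} {f : X ⟶ Y} (hf : IsNull S V f) (hB : B ∈ V) (hS₀ : S₀ ∈ S)
    {c : X ⟶ V₀} {g : V₀ ⟶ S₀} {h : S₀ ⟶ X⟦(1 : ℤ)⟧} (hT : Triangle.mk c g h ∈ distTriang C)
    (b : Y ⟶ B⟦(1 : ℤ)⟧) : ∃ v : V₀ ⟶ B⟦(1 : ℤ)⟧, f ≫ b = c ≫ v :=
  exists_mor₁_comp_eq hT _ (by simpa using hf hS₀ hB h b)

end IsNull

variable {S V : Set C} (hP : IsTriCotorsionPair C S V)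

include hP

lemma IsTriCotorsionPair.isNull_id_of_mem_Kcl {K : C} (hK : K ∈ Kcl C S V) :
    IsNull S V (𝟙 K) := by
  change addMem C (SstarV C S V) K at hK
  induction hK with
  | @of K hK =>
    obtain ⟨S', V', hS', hV', f, g, h, hT⟩ := hK
    intro A B hA hB a b
    obtain ⟨a', rfl⟩ := exists_comp_shift_mor₁_eq hT a (hP.orth hA hV' _)
    rw [CategoryTheory.Functor.map_id, id_comp, assoc, ← Functor.map_comp, hP.orth hS' hB (f ≫ b),
      Functor.map_zero, comp_zero]
  | @iso X Y e _ ih => simpa using (ih.comp_left e.inv).comp_right e.hom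
  | @sum X Y _ _ ihX ihY =>
    have h := ((ihX.comp_left (biprod.fst : X ⊞ Y ⟶ X)).comp_right biprod.inl).add
      ((ihY.comp_left (biprod.snd : X ⊞ Y ⟶ Y)).comp_right biprod.inr)
    simpa [biprod.total] using h
  | @summand X Z _ hs ih =>
    obtain ⟨i, p, hip⟩ := hs
    simpa [hip] using (ih.comp_left i).comp_right p

lemma IsTriCotorsionPair.factorsThru_of_isNull {X Y : C} {f : X ⟶ Y} (hf : IsNull S V f) :
    FactorsThruSet C (Kcl C S V) f := by
  obtain ⟨V₀, S₀, hV₀, hS₀, c, g, h, hX⟩ := hP.coresolve X trivial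
  obtain ⟨V₁, S₁, hV₁, hS₁, d, σ, ρ, hY⟩ := hP.resolve Y trivial
  obtain ⟨s, hs⟩ := exists_comp_shift_mor₂_eq hY (h ≫ f⟦(1 : ℤ)⟧') (by
    simpa using hf hS₀ hV₁ h ρ)
  have hcg : g ≫ h = 0 := comp_distTriang_mor_zero₂₃ _ hX
  obtain ⟨K, i, j, hK⟩ := distinguished_cocone_triangle₂ (g ≫ s)
  obtain ⟨x, hx₁, hx₂⟩ : ∃ x : X ⟶ K, c ≫ 𝟙 V₀ = x ≫ j ∧
      h ≫ x⟦(1 : ℤ)⟧' = s ≫ (-i⟦(1 : ℤ)⟧') :=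
    complete_distinguished_triangle_morphism₁ _ _ hX (rot_of_distTriang _ hK) (𝟙 V₀) s
      (id_comp _).symm
  rw [comp_id] at hx₁
  obtain ⟨y, hy⟩ := exists_mor₁_comp_eq hK (-σ) (by
    simp [← hs, reassoc_of% hcg])
  have hxy : h ≫ (f - x ≫ y)⟦(1 : ℤ)⟧' = 0 := by
    have hy' : i⟦(1 : ℤ)⟧' ≫ y⟦(1 : ℤ)⟧' = -σ⟦(1 : ℤ)⟧' := by
      rw [← Functor.map_comp, ← hy, Functor.map_neg]
    simp [Functor.map_sub, hs, reassoc_of% hx₂, hy']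
  obtain ⟨t, ht⟩ := exists_mor₁_comp_eq hX _ hxy
  refine ⟨K, .of ⟨S₁, V₀, hS₁, hV₀, i, j, _, hK⟩, x, y + j ≫ t, ?_⟩
  rw [Preadditive.comp_add, ← assoc, ← hx₁, ← ht]
  abel

lemma IsTriCotorsionPair.factorsThru_iff_isNull {X Y : C} (f : X ⟶ Y) :
    FactorsThruSet C (Kcl C S V) f ↔ IsNull S V f :=
  ⟨IsNull.of_factorsThru fun _ hK => hP.isNull_id_of_mem_Kcl hK, hP.factorsThru_of_isNull⟩

/-- In a distinguished triangle `Q ⟶ X ⟶ N ⟶ Q⟦1⟧` with `X ⟶ N` null, composition with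
`Q ⟶ X` reflects null morphisms. -/
lemma IsTriCotorsionPair.isNull_of_isNull_mor₁_comp {Q X N W : C} {q : Q ⟶ X} {k : X ⟶ N}
    {δ : N ⟶ Q⟦(1 : ℤ)⟧} (hT : Triangle.mk q k δ ∈ distTriang C) (hk : IsNull S V k)
    {u : X ⟶ W} (hu : IsNull S V (q ≫ u)) : IsNull S V u := by
  intro A B hA hB a b
  obtain ⟨V₁, S₁, hV₁, hS₁, _, σ, ρ, hN⟩ := hP.resolve N trivial
  obtain ⟨V₀, S₀, hV₀, hS₀, c, g, h, hQ⟩ := hP.coresolve Q trivial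
  obtain ⟨s, hs⟩ := exists_comp_shift_mor₂_eq hN (a ≫ k⟦(1 : ℤ)⟧') (by
    simpa using hk hA hV₁ a ρ)
  obtain ⟨v, hv⟩ := hu.exists_comp_eq hB hS₀ hQ b
  obtain ⟨A₀, α, d, hA₀⟩ := distinguished_cocone_triangle₁ c
  obtain ⟨E, x, e, hE⟩ := distinguished_cocone_triangle (α ≫ q)
  obtain ⟨m₁, m₃, comm₁, comm₂, comm₃, comm₄, mem⟩ :=
    Triangulated.someOctahedron rfl hA₀ hT hE
  have hαc : α ≫ c = 0 := comp_distTriang_mor_zero₁₂ _ hA₀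
  obtain ⟨w, hw⟩ : ∃ w : E ⟶ B⟦(1 : ℤ)⟧, u ≫ b = x ≫ w := by
    refine Triangle.yoneda_exact₂ _ hE (u ≫ b) (?_ : (α ≫ q) ≫ u ≫ b = 0)
    rw [assoc] at hv
    rw [assoc, hv, reassoc_of% hαc, zero_comp]
  obtain ⟨σ', hσ'⟩ : ∃ σ' : S₁ ⟶ E, σ = σ' ≫ m₃ :=
    Triangle.coyoneda_exact₃ _ mem σ (hP.orth hS₁ hV₀ _)
  obtain ⟨t, ht⟩ := exists_comp_shift_mor₁_eq mem (a ≫ x⟦(1 : ℤ)⟧' - s ≫ σ'⟦(1 : ℤ)⟧') (by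
    rw [Preadditive.sub_comp, assoc, assoc, ← Functor.map_comp, ← Functor.map_comp, comm₃,
      ← hσ', hs, sub_self])
  rw [hP.orth hA hV₀ t, zero_comp, sub_eq_zero] at ht
  rw [← Functor.map_comp, hw, Functor.map_comp, reassoc_of% ht, ← Functor.map_comp,
    hP.orth hS₁ hB (σ' ≫ w), Functor.map_zero, comp_zero]

/-- In a distinguished triangle `N ⟶ X ⟶ Q ⟶ N⟦1⟧` with `N ⟶ X` null, composition with
`X ⟶ Q` reflects null morphisms. -/
lemma IsTriCotorsionPair.isNull_of_isNull_comp_mor₂ {N X Q W : C} {k : N ⟶ X} {q : X ⟶ Q}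
    {δ : Q ⟶ N⟦(1 : ℤ)⟧} (hT : Triangle.mk k q δ ∈ distTriang C) (hk : IsNull S V k)
    {u : W ⟶ X} (hu : IsNull S V (u ≫ q)) : IsNull S V u := by
  intro A B hA hB a b
  obtain ⟨V₁, S₁, hV₁, hS₁, _, σ, ρ, hQ⟩ := hP.resolve Q trivial
  obtain ⟨V₀, S₀, hV₀, hS₀, c, g, h, hN⟩ := hP.coresolve N trivial
  obtain ⟨v, hv⟩ := hk.exists_comp_eq hB hS₀ hN b
  obtain ⟨E, x, e, hE⟩ := distinguished_cocone_triangle (q ≫ ρ)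
  obtain ⟨m₁, m₃, comm₁, comm₂, comm₃, comm₄, mem⟩ :=
    Triangulated.someOctahedron rfl (rot_of_distTriang _ hT)
      (rot_of_distTriang _ (rot_of_distTriang _ hQ)) hE
  obtain ⟨w, hw⟩ : ∃ w : A ⟶ E, a ≫ u⟦(1 : ℤ)⟧' = w ≫ e := by
    refine Triangle.coyoneda_exact₁ _ hE _ (?_ : (a ≫ u⟦(1 : ℤ)⟧') ≫ (q ≫ ρ)⟦(1 : ℤ)⟧' = 0)
    simpa using hu hA hV₁ a ρ
  change N⟦(1 : ℤ)⟧ ⟶ E at m₁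
  change E ⟶ S₁⟦(1 : ℤ)⟧ at m₃
  replace comm₂ : m₁ ≫ e = -k⟦(1 : ℤ)⟧' := comm₂
  replace mem : Triangle.mk m₁ m₃ ((-σ⟦(1 : ℤ)⟧') ≫ δ⟦(1 : ℤ)⟧') ∈ distTriang C := mem
  obtain ⟨c', hc'⟩ := exists_mor₁_comp_eq mem (c⟦(1 : ℤ)⟧') (by
    have h₀ := congrArg (fun z => z⟦(1 : ℤ)⟧') (hP.orth hS₁ hV₀ (σ ≫ δ ≫ c⟦(1 : ℤ)⟧'))
    simpa using h₀)
  have hsum : e ≫ b⟦(1 : ℤ)⟧' = -(c' ≫ v⟦(1 : ℤ)⟧') := by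
    rw [← add_eq_zero_iff_eq_neg]
    obtain ⟨t, ht⟩ : ∃ t : S₁⟦(1 : ℤ)⟧ ⟶ B⟦(1 : ℤ)⟧⟦(1 : ℤ)⟧,
        e ≫ b⟦(1 : ℤ)⟧' + c' ≫ v⟦(1 : ℤ)⟧' = m₃ ≫ t := by
      refine Triangle.yoneda_exact₂ _ mem _
        (?_ : m₁ ≫ (e ≫ b⟦(1 : ℤ)⟧' + c' ≫ v⟦(1 : ℤ)⟧') = 0)
      rw [Preadditive.comp_add, reassoc_of% comm₂, ← assoc m₁ c', ← hc', ← Functor.map_comp,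
        ← hv]
      simp
    obtain ⟨t, rfl⟩ := (shiftFunctor C (1 : ℤ)).map_surjective t
    rw [ht, hP.orth hS₁ hB t, Functor.map_zero, comp_zero]
  rw [← assoc, hw, assoc, hsum, Preadditive.comp_neg, ← assoc, hP.orth hA hV₀ (w ≫ c'),
    zero_comp, neg_zero]

lemma IsTriCotorsionPair.congruence_Krel : Congruence (Krel C S V) where
  equivalence {X Y} :=
    { refl := fun f => (hP.factorsThru_iff_isNull _).2 (by simpa using IsNull.zero)
      symm := fun {f g} h => (hP.factorsThru_iff_isNull _).2 (by
        simpa using ((hP.factorsThru_iff_isNull _).1 h).neg)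
      trans := fun {f g h} h₁ h₂ => (hP.factorsThru_iff_isNull _).2 (by
        simpa using ((hP.factorsThru_iff_isNull _).1 h₁).add
          ((hP.factorsThru_iff_isNull _).1 h₂)) }
  comp_left f g g' h := (hP.factorsThru_iff_isNull _).2 (by
    simpa using ((hP.factorsThru_iff_isNull _).1 h).comp_left f)
  comp_right g h := (hP.factorsThru_iff_isNull _).2 (by
    simpa using ((hP.factorsThru_iff_isNull _).1 h).comp_right g)

lemma IsTriCotorsionPair.Kproj_map_eq_iff {X Y : C} (f g : X ⟶ Y) :
    (Kproj C S V).map f = (Kproj C S V).map g ↔ IsNull S V (f - g) := by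
  have := hP.congruence_Krel
  rw [← hP.factorsThru_iff_isNull]
  exact Quotient.functor_map_eq_iff _ f g

lemma IsTriCotorsionPair.epi_Kproj_map_iff {X Y : C} (f : X ⟶ Y) :
    Epi ((Kproj C S V).map f) ↔
      ∀ ⦃Z : C⦄ (u : Y ⟶ Z), IsNull S V (f ≫ u) → IsNull S V u := by
  constructor
  · intro hf Z u hu
    have h : (Kproj C S V).map u = (Kproj C S V).map 0 := by
      rw [← cancel_epi ((Kproj C S V).map f), ← Functor.map_comp, ← Functor.map_comp,
        hP.Kproj_map_eq_iff]
      simpa using hu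
    simpa using (hP.Kproj_map_eq_iff _ _).1 h
  · refine fun hf => ⟨fun {Z} u v huv => ?_⟩
    obtain ⟨Z⟩ := Z
    obtain ⟨u, rfl⟩ := (Kproj C S V).map_surjective (X := Y) (Y := Z) u
    obtain ⟨v, rfl⟩ := (Kproj C S V).map_surjective (X := Y) (Y := Z) v
    refine (hP.Kproj_map_eq_iff _ _).2 (hf _ ?_)
    rw [Preadditive.comp_sub, ← hP.Kproj_map_eq_iff, Functor.map_comp, Functor.map_comp]
    exact huv

lemma IsTriCotorsionPair.mono_Kproj_map_iff {X Y : C} (f : X ⟶ Y) :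
    Mono ((Kproj C S V).map f) ↔
      ∀ ⦃W : C⦄ (u : W ⟶ X), IsNull S V (u ≫ f) → IsNull S V u := by
  constructor
  · intro hf W u hu
    have h : (Kproj C S V).map u = (Kproj C S V).map 0 := by
      rw [← cancel_mono ((Kproj C S V).map f), ← Functor.map_comp, ← Functor.map_comp,
        hP.Kproj_map_eq_iff]
      simpa using hu
    simpa using (hP.Kproj_map_eq_iff _ _).1 h
  · refine fun hf => ⟨fun {W} u v huv => ?_⟩
    obtain ⟨W⟩ := W
    obtain ⟨u, rfl⟩ := (Kproj C S V).map_surjective (X := W) (Y := X) u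
    obtain ⟨v, rfl⟩ := (Kproj C S V).map_surjective (X := W) (Y := X) v
    refine (hP.Kproj_map_eq_iff _ _).2 (hf _ ?_)
    rw [Preadditive.sub_comp, ← hP.Kproj_map_eq_iff, Functor.map_comp, Functor.map_comp]
    exact huv

lemma IsTriCotorsionPair.exists_commSq_epi {X Y Z : C} (f : X ⟶ Z) (g : Y ⟶ Z)
    (hg : Epi ((Kproj C S V).map g)) :
    ∃ (Q : C) (q : Q ⟶ X) (r : Q ⟶ Y), q ≫ f = r ≫ g ∧ Epi ((Kproj C S V).map q) := by
  obtain ⟨N, h, d, hT⟩ := distinguished_cocone_triangle g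
  have hgh : g ≫ h = 0 := comp_distTriang_mor_zero₁₂ _ hT
  have hh : IsNull S V h := (hP.epi_Kproj_map_iff g).1 hg h (by rw [hgh]; exact .zero)
  obtain ⟨Q, q, e, hQ⟩ := distinguished_cocone_triangle₁ (f ≫ h)
  obtain ⟨r, hr, -⟩ := complete_distinguished_triangle_morphism₁ _ _ hQ hT f (𝟙 N) (comp_id _)
  exact ⟨Q, q, r, hr, (hP.epi_Kproj_map_iff q).2 fun _ _ hu =>
    hP.isNull_of_isNull_mor₁_comp hQ (hh.comp_left f) hu⟩

lemma IsTriCotorsionPair.exists_commSq_mono {X Y Z : C} (f : Z ⟶ X) (g : Z ⟶ Y)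
    (hg : Mono ((Kproj C S V).map g)) :
    ∃ (Q : C) (q : X ⟶ Q) (r : Y ⟶ Q), f ≫ q = g ≫ r ∧ Mono ((Kproj C S V).map q) := by
  obtain ⟨N, h, d, hT⟩ := distinguished_cocone_triangle₁ g
  have hgh : h ≫ g = 0 := comp_distTriang_mor_zero₁₂ _ hT
  have hh : IsNull S V h := (hP.mono_Kproj_map_iff g).1 hg h (by rw [hgh]; exact .zero)
  obtain ⟨Q, q, e, hQ⟩ := distinguished_cocone_triangle (h ≫ f)
  obtain ⟨r, hr, -⟩ := complete_distinguished_triangle_morphism _ _ hT hQ (𝟙 N) f (id_comp _).symm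
  exact ⟨Q, q, r, hr.symm, (hP.mono_Kproj_map_iff q).2 fun _ _ hu =>
    hP.isNull_of_isNull_comp_mor₂ hQ (hh.comp_right f) hu⟩

lemma IsTriCotorsionPair.epi_fst_of_isPullback {P X Y Z : KQuot C S V} {fst : P ⟶ X}
    {snd : P ⟶ Y} {f : X ⟶ Z} {g : Y ⟶ Z} (h : IsPullback fst snd f g) (hg : Epi g) :
    Epi fst := by
  obtain ⟨X⟩ := X
  obtain ⟨Y⟩ := Y
  obtain ⟨Z⟩ := Z
  obtain ⟨f, rfl⟩ := (Kproj C S V).map_surjective (X := X) (Y := Z) f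
  obtain ⟨g, rfl⟩ := (Kproj C S V).map_surjective (X := Y) (Y := Z) g
  obtain ⟨Q, q, r, comm, hq⟩ := hP.exists_commSq_epi f g hg
  refine @epi_of_epi_fac _ _ _ _ _ _ _ _ hq (h.lift_fst ((Kproj C S V).map q)
    ((Kproj C S V).map r) ?_)
  exact ((Kproj C S V).map_comp q f).symm.trans
    ((congrArg _ comm).trans ((Kproj C S V).map_comp r g))

lemma IsTriCotorsionPair.mono_inl_of_isPushout {Z X Y P : KQuot C S V} {f : Z ⟶ X}
    {g : Z ⟶ Y} {inl : X ⟶ P} {inr : Y ⟶ P} (h : IsPushout f g inl inr) (hg : Mono g) :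
    Mono inl := by
  obtain ⟨X⟩ := X
  obtain ⟨Y⟩ := Y
  obtain ⟨Z⟩ := Z
  obtain ⟨f, rfl⟩ := (Kproj C S V).map_surjective (X := Z) (Y := X) f
  obtain ⟨g, rfl⟩ := (Kproj C S V).map_surjective (X := Z) (Y := Y) g
  obtain ⟨Q, q, r, comm, hq⟩ := hP.exists_commSq_mono f g hg
  refine @mono_of_mono_fac _ _ _ _ _ _ _ _ hq (h.inl_desc ((Kproj C S V).map q)
    ((Kproj C S V).map r) ?_)
  exact ((Kproj C S V).map_comp f q).symm.trans
    ((congrArg _ comm).trans ((Kproj C S V).map_comp g r))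

end Nullity

/-- If `K = add (S * V)` is functorially finite, then `C/K` is integral:
pulling back an epimorphism yields an epimorphism, and pushing out a monomorphism yields
a monomorphism. -/
theorem statement2 (S V : Set C) (hP : IsTriCotorsionPair C S V)
    (hff : FunctoriallyFinite C (Kcl C S V)) :
    (∀ (P X Y Z : KQuot C S V) (fst : P ⟶ X) (snd : P ⟶ Y) (f : X ⟶ Z) (g : Y ⟶ Z),
      IsPullback fst snd f g → (Epi g → Epi fst) ∧ (Epi f → Epi snd)) ∧
    (∀ (Z X Y P : KQuot C S V) (f : Z ⟶ X) (g : Z ⟶ Y) (inl : X ⟶ P) (inr : Y ⟶ P),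
      IsPushout f g inl inr → (Mono g → Mono inl) ∧ (Mono f → Mono inr)) := by
  exact ⟨fun _ _ _ _ _ _ _ _ h =>
      ⟨hP.epi_fst_of_isPullback h, hP.epi_fst_of_isPullback h.flip⟩,
    fun _ _ _ _ _ _ _ _ h =>
      ⟨hP.mono_inl_of_isPushout h, hP.mono_inl_of_isPushout h.flip⟩⟩

end PaperFormalization
end

section
/- Let C be a triangulated category, N a thick subcategory of C, and (S,V) a cotorsion pair in N. Then every morphism f : X → Y in C whose cone lies in N factors as f = f₂ ∘ f₁ through an object Z such that there is a distinguished triangle X →f₁ Z → S → X[1] with S ∈ S and a distinguished triangle V → Z →f₂ Y → V[1] with V ∈ V. -/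
universe w v u v₂ u₂

open CategoryTheory Category Limits Pretriangulated

namespace PaperFormalization

variable (C : Type u) [Category.{v} C] [Preadditive C] [HasZeroObject C]
  [HasShift C ℤ] [∀ n : ℤ, (shiftFunctor C n).Additive] [Pretriangulated C]
  [IsTriangulated C] [HasBinaryBiproducts C]

/-- `N` is a thick subcategory of `C`: it contains the zero objects and is closed under
isomorphisms, shifts, extensions and direct summands. -/
structure IsThick (N : Set C) : Prop where
  zero : ∀ X : C, IsZero X → X ∈ N
  iso : ∀ {X Y : C}, (X ≅ Y) → X ∈ N → Y ∈ N
  shift : ∀ X ∈ N, ∀ n : ℤ, (X⟦n⟧) ∈ N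
  ext₂ : ∀ (T : Triangle C), T ∈ (distTriang C) → T.obj₁ ∈ N → T.obj₃ ∈ N → T.obj₂ ∈ N
  summand : ∀ {X Z : C}, Z ∈ N → IsSummandOf C X Z → X ∈ N

/-- The class of morphisms whose cone lies in `N`. -/
def coneInN (N : Set C) : MorphismProperty C := fun X Y f =>
  ∃ (Z : C) (g : Y ⟶ Z) (h : Z ⟶ (X⟦(1 : ℤ)⟧)), Z ∈ N ∧ Triangle.mk f g h ∈ distTriang C

/-- For a thick subcategory `N` of `C` and a cotorsion pair `(S,V)` in
`N`, every morphism `f : X ⟶ Y` whose cone lies in `N` factors as `f = f₁ ≫ f₂` through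
an object `Z` with a distinguished triangle `X →f₁ Z → S → X⟦1⟧`, `S ∈ S`, and a
distinguished triangle `V → Z →f₂ Y → V⟦1⟧`, `V ∈ V`. -/
theorem statement6 (N S V : Set C) (hN : IsThick C N)
    (hP : IsTriCotorsionPairOn C N S V)
    {X Y : C} (f : X ⟶ Y)
    (hf : ∃ (Z : C) (g : Y ⟶ Z) (h : Z ⟶ (X⟦(1 : ℤ)⟧)),
      Z ∈ N ∧ Triangle.mk f g h ∈ distTriang C) :
    ∃ (Z : C) (f₁ : X ⟶ Z) (f₂ : Z ⟶ Y), f₁ ≫ f₂ = f ∧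
      (∃ (S' : C), S' ∈ S ∧ ∃ (g : Z ⟶ S') (h : S' ⟶ (X⟦(1 : ℤ)⟧)),
        Triangle.mk f₁ g h ∈ distTriang C) ∧
      (∃ (V' : C), V' ∈ V ∧ ∃ (e : V' ⟶ Z) (h : Y ⟶ (V'⟦(1 : ℤ)⟧)),
        Triangle.mk e f₂ h ∈ distTriang C) := by
  obtain ⟨N', g, h, hN', hf⟩ := hf
  obtain ⟨V', S', hV', hS', _, p, t, hres⟩ := hP.resolve N' hN'
  obtain ⟨Z, e, f₂, hZ⟩ := distinguished_cocone_triangle₂ (g ≫ t)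
  let o := Triangulated.someOctahedron' (u₁₂ := g) (u₂₃ := t) rfl hf
    (rot_of_distTriang _ hres) (rot_of_distTriang _ hZ)
  exact ⟨Z, o.m₁, f₂, o.comm₁, ⟨S', hS', o.m₃, _, o.mem⟩, ⟨V', hV', e, _, hZ⟩⟩

end PaperFormalization
end

section
/- Let C be an abelian category with enough projectives, N a Serre subcategory, and (S,V) a cotorsion pair in N. Assume that every object Y of C admits an exact sequence 0 → N → P → Y → N' → 0 with N, N' ∈ N and Hom_C(P, N'') = 0 for all N'' ∈ N. Then for every object X of C there exists a short exact sequence 0 → V → X' → X → 0 with V ∈ V and Ext¹_C(X', V') = 0 for all V' ∈ V; in particular X' → X is a right ^{⊥₁}V-approximation of X, so (^{⊥₁}V, V) is a right cotorsion pair in C, where ^{⊥₁}V := {Y ∈ C : Ext¹_C(Y, V') = 0 for all V' ∈ V}. -/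
universe w v u v₂ u₂

open CategoryTheory Category Limits

namespace PaperFormalization

variable (C : Type u) [Category.{v} C] [Abelian C] [HasExt.{w} C]

/-- `N` is a Serre subcategory of `C`: it is closed under subobjects, quotient objects
and extensions. -/
structure IsSerre (N : Set C) : Prop where
  subobj : ∀ {X Y : C} (f : X ⟶ Y), Mono f → Y ∈ N → X ∈ N
  quot : ∀ {X Y : C} (f : X ⟶ Y), Epi f → X ∈ N → Y ∈ N
  ext : ∀ E : ShortComplex C, E.ShortExact → E.X₁ ∈ N → E.X₃ ∈ N → E.X₂ ∈ N

/-- A cotorsion pair `(S, V)` supported on `N ⊆ C` in the abelian sense. -/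
structure IsAbCotorsionPairOn (N S V : Set C) : Prop where
  S_sub : S ⊆ N
  V_sub : V ⊆ N
  S_iso : ∀ {X Y : C}, (X ≅ Y) → X ∈ S → Y ∈ S
  S_sum : ∀ {X Y : C}, X ∈ S → Y ∈ S → (X ⊞ Y) ∈ S
  S_summand : ∀ {X Z : C}, Z ∈ S → IsSummandOf C X Z → X ∈ S
  V_iso : ∀ {X Y : C}, (X ≅ Y) → X ∈ V → Y ∈ V
  V_sum : ∀ {X Y : C}, X ∈ V → Y ∈ V → (X ⊞ Y) ∈ V
  V_summand : ∀ {X Z : C}, Z ∈ V → IsSummandOf C X Z → X ∈ V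
  orth : ∀ {A B : C}, A ∈ S → B ∈ V → Subsingleton (Abelian.Ext A B 1)
  resolve : ∀ X ∈ N, ∃ (Vx Sx : C), Vx ∈ V ∧ Sx ∈ S ∧
    ∃ (f : Vx ⟶ Sx) (g : Sx ⟶ X) (w : f ≫ g = 0), (ShortComplex.mk f g w).ShortExact
  coresolve : ∀ X ∈ N, ∃ (Vx Sx : C), Vx ∈ V ∧ Sx ∈ S ∧
    ∃ (f : X ⟶ Vx) (g : Vx ⟶ Sx) (w : f ≫ g = 0), (ShortComplex.mk f g w).ShortExact

/-- `^⊥₁V = {X : Ext¹(X, V) = 0 for all V ∈ V}`. -/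
def Perp1Ext (V : Set C) : Set C := {X | ∀ B ∈ V, Subsingleton (Abelian.Ext X B 1)}

/-- Pushing a short exact sequence out along a morphism from its left term yields a short exact
sequence with the same right term. -/
lemma exists_shortExact_of_isPushout {C : Type u} [Category.{v} C] [Abelian C] {K Q X A B : C}
    {k : K ⟶ Q} {p : Q ⟶ X} {w : k ≫ p = 0} (hE : (ShortComplex.mk k p w).ShortExact)
    {φ : K ⟶ A} {i : Q ⟶ B} {j : A ⟶ B} (sq : IsPushout k φ i j) :
    ∃ (q : B ⟶ X) (w' : j ≫ q = 0), (ShortComplex.mk j q w').ShortExact := by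
  have : Mono k := hE.mono_f
  have : Epi p := hE.epi_g
  have w0 : k ≫ p = φ ≫ (0 : A ⟶ X) := by simp [w]
  have hi : i ≫ sq.desc p 0 w0 = p := sq.inl_desc _ _ _
  have hj : j ≫ sq.desc p 0 w0 = 0 := sq.inr_desc _ _ _
  have hlift : ∀ {T : C} (t : B ⟶ T), j ≫ t = 0 → k ≫ i ≫ t = 0 := fun t ht => by
    rw [← Category.assoc, sq.w, Category.assoc, ht, comp_zero]
  have hepi : Epi (sq.desc p 0 w0) := epi_of_epi_fac hi
  have hmono : Mono j := Abelian.mono_inr_of_isColimit _ _ sq.isColimit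
  refine ⟨sq.desc p 0 w0, hj, { exact := ?_, mono_f := hmono, epi_g := hepi }⟩
  refine ShortComplex.exact_of_g_is_cokernel _ (CokernelCofork.IsColimit.ofπ' _ _
    fun {T} t ht => ⟨hE.exact.desc (i ≫ t) (hlift t ht), ?_⟩)
  dsimp at t ht ⊢
  apply sq.hom_ext
  · rw [reassoc_of% hi]
    exact hE.exact.g_desc _ _
  · rw [reassoc_of% hj, ht, zero_comp]

/-- The cobase change of a short exact sequence `0 → K₀ → K → A → 0` along a monomorphism
`K ⟶ Q` is a short exact sequence `0 → K₀ → Q → B → 0`. -/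
lemma shortExact_of_isPushout {C : Type u} [Category.{v} C] [Abelian C] {K₀ K Q A B : C}
    {l : K₀ ⟶ K} {h : K ⟶ A} {w : l ≫ h = 0} (hE : (ShortComplex.mk l h w).ShortExact)
    {k : K ⟶ Q} [Mono k] {i : Q ⟶ B} {j : A ⟶ B} (sq : IsPushout k h i j) :
    ∃ w' : (l ≫ k) ≫ i = 0, (ShortComplex.mk (l ≫ k) i w').ShortExact := by
  have : Mono l := hE.mono_f
  have : Epi h := hE.epi_g
  have w' : (l ≫ k) ≫ i = 0 := by
    rw [Category.assoc, sq.w, reassoc_of% w, zero_comp]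
  have hi : Epi i := by
    refine ⟨fun a b hab => sq.hom_ext hab ?_⟩
    rw [← cancel_epi h, ← Category.assoc, ← Category.assoc, ← sq.w, Category.assoc,
      Category.assoc, hab]
  refine ⟨w', { exact := ?_, mono_f := mono_comp l k, epi_g := hi }⟩
  refine ShortComplex.exact_of_g_is_cokernel _ (CokernelCofork.IsColimit.ofπ' _ _
    fun {T} t ht => ?_)
  dsimp at t ht
  have ht' : l ≫ k ≫ t = 0 := by rw [← Category.assoc, ht]
  exact ⟨sq.desc t (hE.exact.desc (k ≫ t) ht') (hE.exact.g_desc (k ≫ t) ht').symm,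
    sq.inl_desc _ _ _⟩

variable {C} in
/-- If `0 → K → Q → X → 0` is exact with `Q` projective and `Hom(K, W) = 0`, then
`Ext¹(X, W) = 0`. -/
lemma subsingleton_ext_one_of_projective {K Q X W : C} {k : K ⟶ Q} {p : Q ⟶ X} {w : k ≫ p = 0}
    (hE : (ShortComplex.mk k p w).ShortExact) [Projective Q] (hK : ∀ φ : K ⟶ W, φ = 0) :
    Subsingleton (Abelian.Ext X W 1) := by
  refine subsingleton_of_forall_eq 0 fun x => ?_
  obtain ⟨y, hy⟩ := Abelian.Ext.contravariant_sequence_exact₃ hE W x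
    (Abelian.Ext.eq_zero_of_projective _) (add_zero 1)
  obtain ⟨φ, rfl⟩ := (Abelian.Ext.mk₀_bijective K W).2 y
  rw [← hy, hK φ, Abelian.Ext.mk₀_zero, Abelian.Ext.comp_zero]

variable {C} in
/-- Vanishing of `Ext¹(-, W)` is inherited by extensions. -/
lemma subsingleton_ext_one_of_shortExact {X Y Z W : C} {f : X ⟶ Y} {g : Y ⟶ Z} {w : f ≫ g = 0}
    (hE : (ShortComplex.mk f g w).ShortExact) (hX : Subsingleton (Abelian.Ext X W 1))
    (hZ : Subsingleton (Abelian.Ext Z W 1)) : Subsingleton (Abelian.Ext Y W 1) := by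
  refine subsingleton_of_forall_eq 0 fun x => ?_
  obtain ⟨y, hy⟩ := Abelian.Ext.contravariant_sequence_exact₂ hE W x (hX.elim _ _)
  rw [← hy, hZ.elim y 0, Abelian.Ext.comp_zero]

variable {C} in
/-- If `0 → X → Y → Z → 0` is exact and `Ext¹(T, X) = 0`, then every morphism `T ⟶ Z` lifts
to `Y`. -/
lemma exists_lift_of_subsingleton_ext_one {X Y Z T : C} {f : X ⟶ Y} {g : Y ⟶ Z} {w : f ≫ g = 0}
    (hE : (ShortComplex.mk f g w).ShortExact) (hT : Subsingleton (Abelian.Ext T X 1))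
    (φ : T ⟶ Z) : ∃ ψ : T ⟶ Y, ψ ≫ g = φ := by
  obtain ⟨y, hy⟩ := Abelian.Ext.covariant_sequence_exact₃ T hE (Abelian.Ext.mk₀ φ) (zero_add 1)
    (hT.elim _ _)
  obtain ⟨ψ, rfl⟩ := (Abelian.Ext.mk₀_bijective T Y).2 y
  refine ⟨ψ, (Abelian.Ext.mk₀_bijective T Z).1 ?_⟩
  rw [← hy, Abelian.Ext.mk₀_comp_mk₀]

/-- Let `C` be abelian with enough projectives, `N` a Serre subcategory
and `(S,V)` a cotorsion pair in `N`. Assume every object `Y` admits an exact sequence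
`0 → N → P → Y → N' → 0` with `N, N' ∈ N` and `Hom(P, N'') = 0` for all `N'' ∈ N`.
Then every object `X` admits a short exact sequence `0 → V → X' → X → 0` with `V ∈ V`
and `Ext¹(X', V') = 0` for all `V' ∈ V`; in particular `X' → X` is a right
`^⊥₁V`-approximation of `X`, so `(^⊥₁V, V)` is a right cotorsion pair in `C`. -/
theorem statement9 (N S V : Set C) [EnoughProjectives C]
    (hN : IsSerre C N) (hP : IsAbCotorsionPairOn C N S V)
    (hseq : ∀ Y : C, ∃ (N₁ P N₂ : C), N₁ ∈ N ∧ N₂ ∈ N ∧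
      ∃ (f : N₁ ⟶ P) (g : P ⟶ Y) (h : Y ⟶ N₂) (w₁ : f ≫ g = 0) (w₂ : g ≫ h = 0),
        Mono f ∧ (ShortComplex.mk f g w₁).Exact ∧ (ShortComplex.mk g h w₂).Exact ∧
        Epi h ∧ (∀ N₃ ∈ N, ∀ φ : P ⟶ N₃, φ = 0)) :
    ∀ X : C, ∃ (Vx X' : C), Vx ∈ V ∧
      ∃ (f : Vx ⟶ X') (g : X' ⟶ X) (w : f ≫ g = 0),
        (ShortComplex.mk f g w).ShortExact ∧
        (∀ V' ∈ V, Subsingleton (Abelian.Ext X' V' 1)) ∧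
        (∀ Y ∈ Perp1Ext C V, ∀ φ : Y ⟶ X, ∃ ψ : Y ⟶ X', ψ ≫ g = φ) := by
  intro X
  obtain ⟨N₁, P, N₂, -, hN₂, f, g, h, w₁, w₂, -, -, hgh, hh, hP₀⟩ :=
    hseq (kernel (Projective.π X))
  have hK : (ShortComplex.mk (kernel.ι (Projective.π X)) (Projective.π X)
      (kernel.condition _)).ShortExact :=
    { exact := ShortComplex.kernelSequence_exact _
      mono_f := inferInstanceAs (Mono (kernel.ι (Projective.π X)))
      epi_g := inferInstanceAs (Epi (Projective.π X)) }
  have hker : (ShortComplex.mk (kernel.ι h) h (kernel.condition _)).ShortExact :=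
    { exact := ShortComplex.kernelSequence_exact _
      mono_f := inferInstanceAs (Mono (kernel.ι h))
      epi_g := hh }
  have : Epi (kernel.lift h g w₂) := hgh.epi_kernelLift
  have hker₀ : ∀ N₃ ∈ N, ∀ φ : kernel h ⟶ N₃, φ = 0 := fun N₃ hN₃ φ => by
    rw [← cancel_epi (kernel.lift h g w₂), hP₀ N₃ hN₃ (_ ≫ φ), comp_zero]
  have sq := IsPushout.of_hasPushout (kernel.ι (Projective.π X)) h
  obtain ⟨q, wq, hX₀⟩ := exists_shortExact_of_isPushout hK sq
  obtain ⟨_, hQ⟩ := shortExact_of_isPushout hker sq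
  obtain ⟨Vx, Sx, hV, hS, a, b, _, hab⟩ := hP.coresolve N₂ hN₂
  have sq' := IsPushout.of_hasPushout (pushout.inr (kernel.ι (Projective.π X)) h) a
  obtain ⟨r, wr, hX'⟩ := exists_shortExact_of_isPushout hX₀ sq'
  obtain ⟨_, _, hSx⟩ := exists_shortExact_of_isPushout hab sq'.flip
  refine ⟨Vx, _, hV, _, r, wr, hX', fun V' hV' => ?_, fun Y hY φ => ?_⟩
  · exact subsingleton_ext_one_of_shortExact hSx
      (subsingleton_ext_one_of_projective hQ (hker₀ V' (hP.V_sub hV'))) (hP.orth hS hV')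
  · exact exists_lift_of_subsingleton_ext_one hX' (hY Vx hV) φ

end PaperFormalization
end

section
/- Let C be an additive category and I a full subcategory closed under isomorphisms and direct summands. Let 𝕊 be the class of morphisms s : X → Y such that there exist an object I ∈ I and an isomorphism φ : Y ≅ X ⊕ I with φ ∘ s equal to the canonical inclusion X → X ⊕ I. Then the additive quotient functor π : C → C/I sends every morphism of 𝕊 to an isomorphism and is a Gabriel–Zisman localization of C with respect to 𝕊: for every category D and every (not necessarily additive) functor F : C → D sending each morphism of 𝕊 to an isomorphism, there exists a functor F' : C/I → D, unique up to isomorphism, such that F ≅ F' ∘ π. -/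
universe w v u v₂ u₂

open CategoryTheory Category Limits

namespace PaperFormalization

variable (C : Type u) [Category.{v} C] [Preadditive C] [HasBinaryBiproducts C]

/-- The class `𝕊` of sections `s : X ⟶ Y` whose cokernel belongs to `I`: there are
`I₀ ∈ I` and an isomorphism `φ : Y ≅ X ⊞ I₀` with `s ≫ φ.hom` the canonical
inclusion. -/
def SplitClass (I : Set C) : MorphismProperty C := fun X Y s =>
  ∃ I₀ ∈ I, ∃ φ : Y ≅ X ⊞ I₀, s ≫ φ.hom = biprod.inl

/-- The ideal-quotient relation identifying morphisms whose difference factors through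
an object of `I`; the corresponding quotient category is the additive quotient `C/I`. -/
def Irel (I : Set C) : HomRel C := fun {X Y} f g => FactorsThruSet C I (f - g)

/-- The canonical inclusion `X ⟶ X ⊞ Z` with `Z ∈ I` belongs to `𝕊`. -/
theorem splitClass_inl (I : Set C) (X : C) {Z : C} (hZ : Z ∈ I) :
    SplitClass C I (biprod.inl : X ⟶ X ⊞ Z) :=
  ⟨Z, hZ, Iso.refl _, by simp⟩

/-- A functor inverting `𝕊` identifies morphisms whose difference factors through `I`. -/
theorem map_eq_of_irel {D : Type u₂} [Category.{v₂} D] (I : Set C) (F : C ⥤ D)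
    (hF : ∀ ⦃X Y : C⦄ (s : X ⟶ Y), SplitClass C I s → IsIso (F.map s))
    {X Y : C} {f g : X ⟶ Y} (h : Irel C I f g) : F.map f = F.map g := by
  obtain ⟨Z, hZ, a, b, hab⟩ := h
  have : IsIso (F.map (biprod.inl : X ⟶ X ⊞ Z)) := hF _ (splitClass_inl C I X hZ)
  have hfst : IsIso (F.map (biprod.fst : X ⊞ Z ⟶ X)) := by
    have : IsIso (F.map (biprod.inl : X ⟶ X ⊞ Z) ≫ F.map biprod.fst) := by
      rw [← F.map_comp, biprod.inl_fst, F.map_id]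
      infer_instance
    exact IsIso.of_isIso_comp_left (F.map (biprod.inl : X ⟶ X ⊞ Z)) _
  have hlift : F.map (biprod.lift (𝟙 X) a) = F.map biprod.inl := by
    rw [← cancel_mono (F.map (biprod.fst : X ⊞ Z ⟶ X)), ← F.map_comp, ← F.map_comp,
      biprod.lift_fst, biprod.inl_fst]
  have hf : f = biprod.lift (𝟙 X) a ≫ biprod.desc g b := by
    rw [biprod.lift_desc, hab, id_comp, add_sub_cancel]
  rw [hf, F.map_comp, hlift, ← F.map_comp, biprod.inl_desc]

/-- The quotient functor inverts every morphism of `𝕊`. -/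
theorem isIso_quotient_map (I : Set C) {X Y : C} (s : X ⟶ Y) (hs : SplitClass C I s) :
    IsIso ((CategoryTheory.Quotient.functor (Irel C I)).map s) := by
  obtain ⟨Z, hZ, φ, hφ⟩ := hs
  refine ⟨(CategoryTheory.Quotient.functor (Irel C I)).map (φ.hom ≫ biprod.fst), ?_, ?_⟩
  · rw [← Functor.map_comp, reassoc_of% hφ, biprod.inl_fst, CategoryTheory.Functor.map_id]
  · rw [← Functor.map_comp, ← CategoryTheory.Functor.map_id]
    apply CategoryTheory.Quotient.sound
    refine ⟨Z, hZ, φ.hom ≫ biprod.snd, -(biprod.inr ≫ φ.inv), ?_⟩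
    have hs : s = biprod.inl ≫ φ.inv := by rw [← hφ, assoc, φ.hom_inv_id, comp_id]
    have key : φ.hom ≫ (biprod.fst ≫ biprod.inl + biprod.snd ≫ biprod.inr) ≫ φ.inv = 𝟙 Y := by
      rw [biprod.total, id_comp, φ.hom_inv_id]
    rw [hs, ← key]
    simp only [Preadditive.add_comp, Preadditive.comp_add, Preadditive.comp_neg, assoc]
    abel

/-- For an additive category `C` and a full subcategory `I` closed
under isomorphisms and direct summands, the additive quotient functor `π : C ⥤ C/I`
inverts every morphism of `𝕊` and is a Gabriel–Zisman localization of `C` with respect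
to `𝕊`: every (not necessarily additive) functor `F : C ⥤ D` inverting `𝕊` factors
through `π`, uniquely up to isomorphism. -/
theorem statement10 (I : Set C)
    (hIiso : ∀ {X Y : C}, (X ≅ Y) → X ∈ I → Y ∈ I)
    (hIsummand : ∀ {X Z : C}, Z ∈ I → IsSummandOf C X Z → X ∈ I) :
    (∀ ⦃X Y : C⦄ (s : X ⟶ Y), SplitClass C I s →
      IsIso ((CategoryTheory.Quotient.functor (Irel C I)).map s)) ∧
    (∀ {D : Type u₂} [Category.{v₂} D] (F : C ⥤ D),
      (∀ ⦃X Y : C⦄ (s : X ⟶ Y), SplitClass C I s → IsIso (F.map s)) →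
      (∃ F' : CategoryTheory.Quotient (Irel C I) ⥤ D,
        Nonempty (CategoryTheory.Quotient.functor (Irel C I) ⋙ F' ≅ F)) ∧
      (∀ F₁ F₂ : CategoryTheory.Quotient (Irel C I) ⥤ D,
        Nonempty (CategoryTheory.Quotient.functor (Irel C I) ⋙ F₁ ≅ F) →
        Nonempty (CategoryTheory.Quotient.functor (Irel C I) ⋙ F₂ ≅ F) →
        Nonempty (F₁ ≅ F₂))) := by
  refine ⟨fun X Y s hs => isIso_quotient_map C I s hs, fun {D} _ F hF => ⟨?_, ?_⟩⟩
  · exact ⟨CategoryTheory.Quotient.lift _ F fun _ _ _ _ h => map_eq_of_irel C I F hF h,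
      ⟨CategoryTheory.Quotient.lift.isLift _ _ _⟩⟩
  · rintro F₁ F₂ ⟨e₁⟩ ⟨e₂⟩
    exact ⟨CategoryTheory.Quotient.natIsoLift _ (e₁ ≪≫ e₂.symm)⟩

end PaperFormalization
end

section
/- Let C be a triangulated category equipped with a cotorsion pair (S,V) and W := S ∩ V. Then the full subcategories C^- and C^+ are closed under direct summands: if X ⊕ Y belongs to C^- then X belongs to C^-, and if X ⊕ Y belongs to C^+ then X belongs to C^+. -/
universe w v u v₂ u₂

open CategoryTheory Category Limits Pretriangulated

namespace PaperFormalization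

variable (C : Type u) [Category.{v} C] [Preadditive C] [HasZeroObject C]
  [HasShift C ℤ] [∀ n : ℤ, (shiftFunctor C n).Additive] [Pretriangulated C]
  [IsTriangulated C] [HasBinaryBiproducts C]

/-- The subcategory `C⁻` of objects `X` admitting a distinguished triangle
`X → W → S → X⟦1⟧` with `W ∈ S ∩ V` and `S ∈ S`. -/
def Cminus (S V : Set C) : Set C :=
  {X | ∃ (W' S' : C), W' ∈ S ∩ V ∧ S' ∈ S ∧
    ∃ (f : X ⟶ W') (g : W' ⟶ S') (h : S' ⟶ (X⟦(1 : ℤ)⟧)),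
      Triangle.mk f g h ∈ distTriang C}

/-- The subcategory `C⁺` of objects `X` admitting a distinguished triangle
`V → W → X → V⟦1⟧` with `V ∈ V` and `W ∈ S ∩ V`. -/
def Cplus (S V : Set C) : Set C :=
  {X | ∃ (V' W' : C), V' ∈ V ∧ W' ∈ S ∩ V ∧
    ∃ (f : V' ⟶ W') (g : W' ⟶ X) (h : X ⟶ (V'⟦(1 : ℤ)⟧)),
      Triangle.mk f g h ∈ distTriang C}

/-- The subcategory `H = C⁺ ∩ C⁻`. -/
def Hcl (S V : Set C) : Set C := Cplus C S V ∩ Cminus C S V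

/-- A morphism out of the first object of a distinguished triangle extends along the first map
as soon as its shift is killed by the connecting map. -/
theorem exists_extension {A B D E : C} {f : A ⟶ B} {g : B ⟶ D} {h : D ⟶ A⟦(1 : ℤ)⟧}
    (hT : Triangle.mk f g h ∈ distTriang C) (a : A ⟶ E) (ha : h ≫ a⟦(1 : ℤ)⟧' = 0) :
    ∃ b : B ⟶ E, a = f ≫ b := by
  obtain ⟨b, hb⟩ : ∃ b : B⟦(1 : ℤ)⟧ ⟶ E⟦(1 : ℤ)⟧, a⟦(1 : ℤ)⟧' = (-f⟦(1 : ℤ)⟧') ≫ b :=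
    Triangle.yoneda_exact₃ _ (rot_of_distTriang _ hT) (a⟦(1 : ℤ)⟧') ha
  obtain ⟨c, rfl⟩ := (shiftFunctor C (1 : ℤ)).map_surjective b
  refine ⟨-c, (shiftFunctor C (1 : ℤ)).map_injective ?_⟩
  rw [hb, Functor.map_comp, Functor.map_neg, Preadditive.neg_comp, Preadditive.comp_neg]

variable {C} in
/-- In a cotorsion pair, the left class is the left orthogonal of the shifted right class. -/
theorem IsTriCotorsionPairOn.mem_left_of_orth {S V : Set C} (hP : IsTriCotorsionPair C S V) {A : C}
    (hA : ∀ B ∈ V, ∀ f : A ⟶ B⟦(1 : ℤ)⟧, f = 0) : A ∈ S := by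
  obtain ⟨V₀, S₀, hV, hS, f, g, h, hT⟩ := hP.resolve A (Set.mem_univ A)
  obtain ⟨s, hs⟩ := Triangle.coyoneda_exact₃ _ hT (𝟙 A) ((id_comp h).trans (hA V₀ hV h))
  exact hP.S_summand hS ⟨s, g, hs.symm⟩

variable {C} in
/-- In a cotorsion pair, the right class is the right orthogonal of the desuspended left class. -/
theorem IsTriCotorsionPairOn.mem_right_of_orth {S V : Set C} (hP : IsTriCotorsionPair C S V)
    {B : C} (hB : ∀ A ∈ S, ∀ f : A ⟶ B⟦(1 : ℤ)⟧, f = 0) : B ∈ V := by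
  obtain ⟨V₀, S₀, hV, hS, f, g, h, hT⟩ := hP.coresolve B (Set.mem_univ B)
  obtain ⟨r, hr⟩ := exists_extension C hT (𝟙 B) (by simpa using hB S₀ hS h)
  exact hP.V_summand hV ⟨f, r, hr.symm⟩

variable {C} in
theorem Cminus_of_isSummandOf {S V : Set C} (hP : IsTriCotorsionPair C S V) {X Z : C}
    (hZ : Z ∈ Cminus C S V) (hX : IsSummandOf C X Z) : X ∈ Cminus C S V := by
  obtain ⟨W, S₁, hW, hS₁, a, b, c, hT⟩ := hZ
  obtain ⟨i, p, hip⟩ := hX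
  obtain ⟨V₀, S₀, hV, hS, f, g, h, hT₀⟩ := hP.coresolve X (Set.mem_univ X)
  refine ⟨V₀, S₀, ⟨hP.mem_left_of_orth fun B hB φ ↦ ?_, hV⟩, hS, f, g, h, hT₀⟩
  obtain ⟨t, ht⟩ := exists_extension C hT (p ≫ f) (hP.orth hS₁ hV _)
  have hf : f ≫ φ = 0 :=
    calc f ≫ φ = i ≫ (p ≫ f) ≫ φ := by simp [reassoc_of% hip]
      _ = (i ≫ a) ≫ (t ≫ φ) := by simp [ht]
      _ = 0 := by rw [hP.orth hW.1 hB (t ≫ φ), comp_zero]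
  obtain ⟨ψ, hψ⟩ : ∃ ψ : S₀ ⟶ B⟦(1 : ℤ)⟧, φ = g ≫ ψ := Triangle.yoneda_exact₂ _ hT₀ φ hf
  rw [hψ, hP.orth hS hB ψ, comp_zero]

variable {C} in
theorem Cplus_of_isSummandOf {S V : Set C} (hP : IsTriCotorsionPair C S V) {X Z : C}
    (hZ : Z ∈ Cplus C S V) (hX : IsSummandOf C X Z) : X ∈ Cplus C S V := by
  obtain ⟨V₁, W, hV₁, hW, a, b, c, hT⟩ := hZ
  obtain ⟨i, p, hip⟩ := hX
  obtain ⟨V₀, S₀, hV, hS, f, g, h, hT₀⟩ := hP.resolve X (Set.mem_univ X)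
  refine ⟨V₀, S₀, hV, ⟨hS, hP.mem_right_of_orth fun A hA φ ↦ ?_⟩, f, g, h, hT₀⟩
  obtain ⟨t, ht⟩ : ∃ t : S₀ ⟶ W, g ≫ i = t ≫ b :=
    Triangle.coyoneda_exact₃ _ hT (g ≫ i) (hP.orth hS hV₁ _)
  have hg : φ ≫ g⟦(1 : ℤ)⟧' = 0 :=
    calc φ ≫ g⟦(1 : ℤ)⟧' = φ ≫ (g ≫ i)⟦(1 : ℤ)⟧' ≫ p⟦(1 : ℤ)⟧' := by
          rw [← Functor.map_comp, assoc, hip, comp_id]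
      _ = (φ ≫ t⟦(1 : ℤ)⟧') ≫ (b ≫ p)⟦(1 : ℤ)⟧' := by simp [ht]
      _ = 0 := by rw [hP.orth hA hW.2 (φ ≫ t⟦(1 : ℤ)⟧'), zero_comp]
  have hg' : φ ≫ (-g⟦(1 : ℤ)⟧') = 0 := by rw [Preadditive.comp_neg, hg, neg_zero]
  obtain ⟨ψ, hψ⟩ : ∃ ψ : A ⟶ V₀⟦(1 : ℤ)⟧, φ = ψ ≫ (-f⟦(1 : ℤ)⟧') :=
    Triangle.coyoneda_exact₃ _ (rot_of_distTriang _ (rot_of_distTriang _ hT₀)) φ hg'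
  rw [hψ, hP.orth hA hV ψ, zero_comp]

/-- For a cotorsion pair `(S,V)` on `C`, the subcategories `C⁻` and
`C⁺` are closed under direct summands. -/
theorem statement11 (S V : Set C) (hP : IsTriCotorsionPair C S V) :
    (∀ X Y : C, (X ⊞ Y) ∈ Cminus C S V → X ∈ Cminus C S V) ∧
    (∀ X Y : C, (X ⊞ Y) ∈ Cplus C S V → X ∈ Cplus C S V) :=
  ⟨fun _ _ h ↦ Cminus_of_isSummandOf hP h ⟨biprod.inl, biprod.fst, biprod.inl_fst⟩,
    fun _ _ h ↦ Cplus_of_isSummandOf hP h ⟨biprod.inl, biprod.fst, biprod.inl_fst⟩⟩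

end PaperFormalization
end

section
/- Let C be a triangulated category equipped with a cotorsion pair (S,V) and W := S ∩ V. Then S ⊆ C^- and V ⊆ C^+; that is, every object of S admits a distinguished triangle X → W → S → X[1] with W ∈ W and S ∈ S, and every object of V admits a distinguished triangle V' → W → X → V'[1] with V' ∈ V and W ∈ W. -/
universe w v u v₂ u₂

open CategoryTheory Category Limits Pretriangulated

namespace PaperFormalization

variable (C : Type u) [Category.{v} C] [Preadditive C] [HasZeroObject C]
  [HasShift C ℤ] [∀ n : ℤ, (shiftFunctor C n).Additive] [Pretriangulated C]
  [IsTriangulated C] [HasBinaryBiproducts C]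

variable {C} in
/-- The first class of a cotorsion pair is the left orthogonal of the shifted second class. -/
lemma IsTriCotorsionPair.mem_left {S V : Set C} (hP : IsTriCotorsionPair C S V) {X : C}
    (hX : ∀ B ∈ V, ∀ f : X ⟶ B⟦(1 : ℤ)⟧, f = 0) : X ∈ S := by
  obtain ⟨B, A, hB, hA, f, g, h, hT⟩ := hP.resolve X (Set.mem_univ X)
  obtain ⟨i, hi⟩ := Triangle.coyoneda_exact₃ _ hT (𝟙 X) ((id_comp h).trans (hX B hB h))
  exact hP.S_summand hA ⟨i, g, hi.symm⟩

variable {C} in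
/-- The shifted second class of a cotorsion pair is the right orthogonal of the first class. -/
lemma IsTriCotorsionPair.mem_right {S V : Set C} (hP : IsTriCotorsionPair C S V) {X : C}
    (hX : ∀ A ∈ S, ∀ f : A ⟶ X⟦(1 : ℤ)⟧, f = 0) : X ∈ V := by
  obtain ⟨B, A, hB, hA, f, g, h, hT⟩ := hP.coresolve X (Set.mem_univ X)
  have : Mono f := Triangle.mono₁ _ hT (hX A hA h)
  have : IsSplitMono f := isSplitMono_of_mono f
  exact hP.V_summand hB ⟨f, retraction f, IsSplitMono.id f⟩

variable {C} in
/-- The first class of a cotorsion pair is closed under extensions. -/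
lemma IsTriCotorsionPair.left_ext {S V : Set C} (hP : IsTriCotorsionPair C S V)
    {T : Triangle C} (hT : T ∈ distTriang C) (h₁ : T.obj₁ ∈ S) (h₃ : T.obj₃ ∈ S) :
    T.obj₂ ∈ S := by
  refine hP.mem_left fun B hB f => ?_
  obtain ⟨g, rfl⟩ := Triangle.yoneda_exact₂ _ hT f (hP.orth h₁ hB _)
  rw [hP.orth h₃ hB g, comp_zero]

variable {C} in
/-- The second class of a cotorsion pair is closed under extensions. -/
lemma IsTriCotorsionPair.right_ext {S V : Set C} (hP : IsTriCotorsionPair C S V)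
    {T : Triangle C} (hT : T ∈ distTriang C) (h₁ : T.obj₁ ∈ V) (h₃ : T.obj₃ ∈ V) :
    T.obj₂ ∈ V := by
  refine hP.mem_right fun A hA f => ?_
  obtain ⟨g, rfl⟩ := Triangle.coyoneda_exact₂ _
    (rot_of_distTriang _ (rot_of_distTriang _ (rot_of_distTriang _ hT))) f
    (by
      change f ≫ (-T.mor₂⟦(1 : ℤ)⟧') = 0
      exact hP.orth hA h₃ _)
  rw [show g = 0 from hP.orth hA h₁ g, zero_comp]
  rfl

/-- For a cotorsion pair `(S,V)` on `C`, one has `S ⊆ C⁻` and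
`V ⊆ C⁺`. -/
theorem statement12 (S V : Set C) (hP : IsTriCotorsionPair C S V) :
    S ⊆ Cminus C S V ∧ V ⊆ Cplus C S V := by
  refine ⟨fun X hX => ?_, fun X hX => ?_⟩
  · obtain ⟨B, A, hB, hA, f, g, h, hT⟩ := hP.coresolve X (Set.mem_univ X)
    exact ⟨B, A, ⟨hP.left_ext hT hX hA, hB⟩, hA, f, g, h, hT⟩
  · obtain ⟨B, A, hB, hA, f, g, h, hT⟩ := hP.resolve X (Set.mem_univ X)
    exact ⟨B, A, hB, ⟨hA, hP.right_ext hT hB hX⟩, f, g, h, hT⟩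

end PaperFormalization
end

section
/- Let C be a triangulated category equipped with a cotorsion pair (S,V) and W := S ∩ V. Then S ∩ C^+ = W and V ∩ C^- = W; in particular, every object of S admitting a distinguished triangle V → W → X → V[1] with V ∈ V, W ∈ W belongs to W, and every object of V admitting a distinguished triangle X → W → S → X[1] with W ∈ W, S ∈ S belongs to W. -/
universe w v u v₂ u₂

open CategoryTheory Category Limits Pretriangulated

namespace PaperFormalization

variable (C : Type u) [Category.{v} C] [Preadditive C] [HasZeroObject C]
  [HasShift C ℤ] [∀ n : ℤ, (shiftFunctor C n).Additive] [Pretriangulated C]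
  [IsTriangulated C] [HasBinaryBiproducts C]

open scoped ZeroObject

variable {C}

omit [IsTriangulated C] [HasBinaryBiproducts C] in
/-- If the connecting morphism of a distinguished triangle vanishes, then the third object is a
direct summand of the second. -/
lemma isSummandOf_obj₃ {T : Triangle C} (hT : T ∈ distTriang C) (h : T.mor₃ = 0) :
    IsSummandOf C T.obj₃ T.obj₂ := by
  have := T.epi₂ hT h
  have := isSplitEpi_of_epi T.mor₂
  exact ⟨section_ T.mor₂, T.mor₂, IsSplitEpi.id _⟩

omit [IsTriangulated C] [HasBinaryBiproducts C] in
/-- If the connecting morphism of a distinguished triangle vanishes, then the first object is a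
direct summand of the second. -/
lemma isSummandOf_obj₁ {T : Triangle C} (hT : T ∈ distTriang C) (h : T.mor₃ = 0) :
    IsSummandOf C T.obj₁ T.obj₂ := by
  have := T.mono₁ hT h
  have := isSplitMono_of_mono T.mor₁
  exact ⟨T.mor₁, retraction T.mor₁, IsSplitMono.id _⟩

omit [HasShift C ℤ] [∀ n : ℤ, (shiftFunctor C n).Additive] [Pretriangulated C]
  [IsTriangulated C] [HasBinaryBiproducts C] in
/-- The zero object is a direct summand of every object. -/
lemma isSummandOf_zero (X : C) : IsSummandOf C (0 : C) X :=
  ⟨0, 0, Subsingleton.elim _ _⟩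

variable (C)

/-- For a cotorsion pair `(S,V)` on `C`, one has `S ∩ C⁺ = W` and
`V ∩ C⁻ = W`, where `W = S ∩ V`. -/
theorem statement13 (S V : Set C) (hP : IsTriCotorsionPair C S V) :
    S ∩ Cplus C S V = S ∩ V ∧ V ∩ Cminus C S V = S ∩ V := by
  refine ⟨Set.ext fun X => ⟨?_, ?_⟩, Set.ext fun X => ⟨?_, ?_⟩⟩
  · rintro ⟨hX, V', W', hV', hW', f, g, h, hT⟩
    exact ⟨hX, hP.V_summand hW'.2 (isSummandOf_obj₃ hT (hP.orth hX hV' h))⟩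
  · rintro ⟨hS, hV⟩
    exact ⟨hS, 0, X, hP.V_summand hV (isSummandOf_zero X), ⟨hS, hV⟩, _, _, _,
      contractible_distinguished₁ X⟩
  · rintro ⟨hX, W', S', hW', hS', f, g, h, hT⟩
    exact ⟨hP.S_summand hW'.1 (isSummandOf_obj₁ hT (hP.orth hS' hX h)), hX⟩
  · rintro ⟨hS, hV⟩
    exact ⟨hV, X, 0, ⟨hS, hV⟩, hP.S_summand hS (isSummandOf_zero X), _, _, _,
      contractible_distinguished X⟩

end PaperFormalization
end
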